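/- Let f ∈ ℤ[x] be a polynomial that is irreducible over ℚ of degree at least 2. Then the set S_f of primes p such that f has no root modulo p has positive natural density. In particular S_f is infinite. -/

import Mathlib

namespace Tauber
open MeasureTheory Filter Topology Set Complex

noncomputable def tri (u : ℝ) : ℝ := max 0 (1 - |u|)

noncomputable def ker (y : ℝ) : ℝ := Real.sinc (y / 2) ^ 2

lemma continuous_tri : Continuous tri := by unfold tri; fun_prop

lemma tri_eq_zero {u : ℝ} (hu : u ∉ Ioc (-1 : ℝ) 1) : tri u = 0 := by
  unfold tri
  rw [max_eq_left]
  simp only [mem_Ioc, not_and_or, not_lt, not_le] at hu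
  rcases hu with h | h
  · have := neg_le_abs u; linarith
  · have := le_abs_self u; linarith

lemma tri_nonneg (u : ℝ) : 0 ≤ tri u := le_max_left _ _

lemma tri_le_one (u : ℝ) : tri u ≤ 1 := by
  unfold tri; exact max_le zero_le_one (by linarith [abs_nonneg u])

lemma compactSupport_tri : HasCompactSupport tri :=
  HasCompactSupport.intro (isCompact_Icc (a := (-1:ℝ)) (b := 1))
    (fun u hu => tri_eq_zero (fun h => hu (Ioc_subset_Icc_self h)))

lemma continuous_ker : Continuous ker := by
  unfold ker
  exact (Real.continuous_sinc.comp (continuous_id.div_const 2)).pow 2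

lemma ker_nonneg (y : ℝ) : 0 ≤ ker y := sq_nonneg _

lemma ker_bound (y : ℝ) : ker y ≤ 5 * (1 + y ^ 2)⁻¹ := by
  rw [← div_eq_mul_inv, le_div_iff₀ (by positivity)]
  have h1 : ker y ≤ 1 := by
    unfold ker
    have := Real.abs_sinc_le_one (y / 2)
    rw [← sq_abs]
    exact pow_le_one₀ (abs_nonneg _) this
  have h2 : ker y * y ^ 2 ≤ 4 := by
    unfold ker
    by_cases hy : y = 0
    · simp [hy]
    · rw [Real.sinc_of_ne_zero (by simpa using hy)]
      have : (Real.sin (y / 2) / (y / 2)) ^ 2 * y ^ 2 = 4 * Real.sin (y/2) ^ 2 := by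
        field_simp; norm_num; ring
      rw [this]
      nlinarith [Real.sin_sq_le_one (y/2)]
  nlinarith

lemma integrable_ker : Integrable ker := by
  refine Integrable.mono' (integrable_inv_one_add_sq.const_mul 5) continuous_ker.aestronglyMeasurable ?_
  filter_upwards with y
  rw [Real.norm_eq_abs, abs_of_nonneg (ker_nonneg y)]
  exact ker_bound y

lemma integral_ker_pos : 0 < ∫ y, ker y := by
  rw [integral_pos_iff_support_of_nonneg ker_nonneg integrable_ker]
  refine (continuous_ker.isOpen_support).measure_pos volume ⟨0, ?_⟩
  simp [ker]

lemma integral_tri (y : ℝ) : ∫ u, (tri u : ℂ) * cexp (I * (u * y)) = (ker y : ℂ) := by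
  have h1 : ∫ u, (tri u : ℂ) * cexp (I * (u * y)) =
      ∫ u in (-1:ℝ)..1, (tri u : ℂ) * cexp (I * (u * y)) := by
    rw [intervalIntegral.integral_of_le (by norm_num)]
    symm
    apply setIntegral_eq_integral_of_forall_compl_eq_zero
    intro u hu
    simp [tri_eq_zero hu]
  have hc : Continuous fun u : ℝ => (tri u : ℂ) * cexp (I * (u * y)) := by
    have := continuous_tri
    fun_prop
  rw [h1, ← intervalIntegral.integral_add_adjacent_intervals (b := 0)
    (hc.intervalIntegrable _ _) (hc.intervalIntegrable _ _)]
  have e1 : ∫ u in (-1:ℝ)..0, (tri u : ℂ) * cexp (I * (u * y)) =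
      ∫ u in (-1:ℝ)..0, (1 + u : ℂ) * cexp ((I * y) * u) := by
    apply intervalIntegral.integral_congr
    intro u hu
    rw [uIcc_of_le (by norm_num)] at hu
    have : tri u = 1 + u := by
      unfold tri; rw [abs_of_nonpos hu.2, max_eq_right (by linarith [hu.1])]; ring
    simp only [this]; push_cast; congr 2; ring
  have e2 : ∫ u in (0:ℝ)..1, (tri u : ℂ) * cexp (I * (u * y)) =
      ∫ u in (0:ℝ)..1, (1 - u : ℂ) * cexp ((I * y) * u) := by
    apply intervalIntegral.integral_congr
    intro u hu
    rw [uIcc_of_le (by norm_num)] at hu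
    have : tri u = 1 - u := by
      unfold tri; rw [abs_of_nonneg hu.1, max_eq_right (by linarith [hu.2])]
    simp only [this]; push_cast; congr 2; ring
  rw [e1, e2]
  by_cases hy : y = 0
  · subst hy
    have a1 : ∫ u in (-1:ℝ)..0, ((1 + u : ℝ) : ℂ) = ((1/2 : ℝ) : ℂ) := by
      rw [intervalIntegral.integral_ofReal]; congr 1
      rw [intervalIntegral.integral_add (by simp) (by simp)]; simp; norm_num
    have a2 : ∫ u in (0:ℝ)..1, ((1 - u : ℝ) : ℂ) = ((1/2 : ℝ) : ℂ) := by
      rw [intervalIntegral.integral_ofReal]; congr 1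
      rw [intervalIntegral.integral_sub (by simp) (by simp)]; simp; norm_num
    push_cast at a1 a2
    simp [ker, a1, a2]; norm_num
  · set c : ℂ := I * y with hcdef
    have hc0 : c ≠ 0 := by simp [hcdef, hy]
    have d0 : ∀ u : ℝ, HasDerivAt (fun u : ℝ => cexp (c * u)) (c * cexp (c * u)) u := by
      intro u
      have h2 : HasDerivAt (fun u : ℝ => c * (u : ℂ)) c u := by
        simpa using (HasDerivAt.ofReal_comp (hasDerivAt_id u)).const_mul c
      simpa [mul_comm] using h2.cexp
    have d00 : ∀ u : ℝ, HasDerivAt (fun u : ℝ => (u : ℂ)) 1 u := fun u => by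
      simpa using (HasDerivAt.ofReal_comp (hasDerivAt_id u))
    have d1 : ∀ u : ℝ, HasDerivAt (fun u : ℝ => ((1 + u) / c - 1 / c^2 : ℂ) * cexp (c * u))
        ((1 + u : ℂ) * cexp (c * u)) u := by
      intro u
      have := ((((d00 u).const_add 1).div_const c).sub_const (1 / c^2)).mul (d0 u)
      refine this.congr_deriv ?_
      field_simp; ring
    have d2 : ∀ u : ℝ, HasDerivAt (fun u : ℝ => ((1 - u) / c + 1 / c^2 : ℂ) * cexp (c * u))
        ((1 - u : ℂ) * cexp (c * u)) u := by
      intro u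
      have := ((((d00 u).const_sub 1).div_const c).add_const (1 / c^2)).mul (d0 u)
      refine this.congr_deriv ?_
      field_simp; ring
    rw [intervalIntegral.integral_eq_sub_of_hasDerivAt (fun u _ => d1 u)
        (Continuous.intervalIntegrable (by fun_prop) _ _),
      intervalIntegral.integral_eq_sub_of_hasDerivAt (fun u _ => d2 u)
        (Continuous.intervalIntegrable (by fun_prop) _ _)]
    have hk : ker y = 2 * (1 - Real.cos y) / y^2 := by
      unfold ker
      rw [Real.sinc_of_ne_zero (by simpa using hy)]
      have : Real.cos y = 1 - 2 * Real.sin (y/2)^2 := by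
        have := Real.cos_two_mul (y/2)
        rw [Real.cos_sq'] at this
        rw [show 2 * (y/2) = y by ring] at this
        linarith
      rw [this]; field_simp; ring
    rw [hk]
    push_cast
    have hcos : Complex.cos y = (cexp c + cexp (-c)) / 2 := by
      rw [Complex.cos, hcdef]; congr 2 <;> ring_nf
    rw [hcos]
    have hc2 : (y:ℂ)^2 = - c^2 := by rw [hcdef, mul_pow, I_sq]; ring
    rw [hc2]
    simp only [mul_neg, mul_one, mul_zero, Complex.exp_zero]
    field_simp
    ring
end Tauber


namespace Tauber
open MeasureTheory Filter Topology Set Complex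

/-- For a bounded function whose Laplace transform extends continuously to the closed right half
plane, the Fejer means tend to zero. -/
lemma fejer_tendsto (f : ℝ → ℝ) (hfm : Measurable f) (M : ℝ) (hM : ∀ t, |f t| ≤ M)
    (g : ℂ → ℂ) (hg : ContinuousOn g {w | 0 ≤ w.re})
    (hfg : ∀ w : ℂ, 0 < w.re → g w = ∫ t in Ioi (0:ℝ), (f t : ℂ) * cexp (-(w * t)))
    (l : ℝ) (hl : 0 < l) :
    Tendsto (fun x : ℝ => ∫ t in Ioi (0:ℝ), f t * ker (l * (x - t))) atTop (𝓝 0) := by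
  have hM0 : 0 ≤ M := (abs_nonneg _).trans (hM 0)
  have hkint : ∀ x : ℝ, Integrable (fun t => ker (l * (x - t))) := by
    intro x
    have := (integrable_ker.comp_mul_left' hl.ne').comp_sub_left x
    simpa using this
  -- identity with ε
  have key : ∀ x ε : ℝ, 0 < ε →
      ∫ t in Ioi (0:ℝ), ((f t * Real.exp (-(ε * t)) * ker (l * (x - t)) : ℝ) : ℂ) =
      ∫ u : ℝ, (tri u : ℂ) * cexp (I * (u * (l * x))) * g (ε + I * (l * u)) := by
    intro x ε hε
    have h1 : ∀ t : ℝ, ((f t * Real.exp (-(ε * t)) * ker (l * (x - t)) : ℝ) : ℂ) =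
        ∫ u : ℝ, (f t : ℂ) * cexp (-(ε * t)) * ((tri u : ℂ) * cexp (I * (u * (l * (x - t))))) := by
      intro t
      rw [integral_const_mul]
      have := integral_tri (l * (x - t))
      push_cast at this ⊢
      rw [this]
    simp_rw [h1]
    rw [integral_integral_swap]
    · refine integral_congr_ae (ae_of_all _ fun u => ?_)
      simp only
      rw [hfg _ (by simpa using hε), ← integral_const_mul]
      refine integral_congr_ae (ae_of_all _ fun t => ?_)
      simp only
      have : cexp (-(ε * t)) * cexp (I * (u * (l * (x - t)))) =
          cexp (I * (u * (l * x))) * cexp (-((ε + I * (l * u)) * t)) := by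
        rw [← Complex.exp_add, ← Complex.exp_add]; congr 1; ring
      linear_combination (f t : ℂ) * (tri u : ℂ) * this
    · have hA : Integrable (fun t : ℝ => (f t : ℂ) * cexp (-(ε * t))) (volume.restrict (Ioi 0)) := by
        refine Integrable.mono' ((exp_neg_integrableOn_Ioi 0 hε).const_mul M) ?_ ?_
        · have : Measurable fun t : ℝ => (f t : ℂ) := measurable_ofReal.comp hfm
          exact (this.mul (by fun_prop)).aestronglyMeasurable
        · filter_upwards with t
          rw [norm_mul, Complex.norm_exp, norm_real, Real.norm_eq_abs]
          simp only [neg_re, re_ofReal_mul, ofReal_re, neg_mul]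
          exact mul_le_mul_of_nonneg_right (hM t) (Real.exp_pos _).le
      have hB : Integrable (fun u : ℝ => (tri u : ℂ)) :=
        (continuous_tri.integrable_of_hasCompactSupport compactSupport_tri).ofReal
      have hAB := hA.mul_prod hB
      refine Integrable.mono' hAB.norm ?_ ?_
      · have : Measurable fun t : ℝ => (f t : ℂ) := measurable_ofReal.comp hfm
        have h2 : Measurable (Function.uncurry fun t u : ℝ => (f t : ℂ) * cexp (-(ε * t)) *
            ((tri u : ℂ) * cexp (I * (u * (l * (x - t)))))) := by
          have h3 : Measurable tri := continuous_tri.measurable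
          unfold Function.uncurry
          have h4 : Measurable fun p : ℝ × ℝ => (f p.1 : ℂ) := this.comp measurable_fst
          have h5 : Measurable fun p : ℝ × ℝ => (tri p.2 : ℂ) :=
            measurable_ofReal.comp (h3.comp measurable_snd)
          exact (h4.mul (by fun_prop)).mul (h5.mul (by fun_prop))
        exact h2.aestronglyMeasurable
      · filter_upwards with p
        simp only [Function.uncurry, norm_mul]
        have : ‖cexp (I * (p.2 * (l * (x - p.1))))‖ = 1 := by
          have := Complex.norm_exp_I_mul_ofReal (p.2 * (l * (x - p.1)))
          push_cast at this; exact this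
        rw [this]; simp
  -- pass to the limit
  have lim : ∀ x : ℝ, ((∫ t in Ioi (0:ℝ), f t * ker (l * (x - t)) : ℝ) : ℂ) =
      ∫ u : ℝ, (tri u : ℂ) * cexp (I * (u * (l * x))) * g (I * (l * u)) := by
    intro x
    have L1 : Tendsto (fun ε : ℝ => ∫ t in Ioi (0:ℝ),
        ((f t * Real.exp (-(ε * t)) * ker (l * (x - t)) : ℝ) : ℂ)) (𝓝[>] 0)
        (𝓝 (∫ t in Ioi (0:ℝ), ((f t * ker (l * (x - t)) : ℝ) : ℂ))) := by
      apply tendsto_integral_filter_of_dominated_convergence (fun t => M * ker (l * (x - t)))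
      · filter_upwards with ε
        have : Measurable fun t : ℝ => f t * Real.exp (-(ε * t)) * ker (l * (x - t)) := by
          have := continuous_ker.measurable
          fun_prop
        exact (measurable_ofReal.comp this).aestronglyMeasurable
      · filter_upwards [self_mem_nhdsWithin] with ε hε
        filter_upwards [ae_restrict_mem measurableSet_Ioi] with t ht
        rw [norm_real, norm_mul, norm_mul, Real.norm_eq_abs, Real.norm_eq_abs, Real.norm_eq_abs,
          abs_of_nonneg (ker_nonneg _), abs_of_pos (Real.exp_pos _)]
        refine mul_le_mul_of_nonneg_right ?_ (ker_nonneg _)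
        have : Real.exp (-(ε * t)) ≤ 1 := by
          rw [Real.exp_le_one_iff]; have := mul_pos (mem_Ioi.1 hε) (mem_Ioi.1 ht); simpa using this.le
        calc |f t| * Real.exp (-(ε * t)) ≤ M * 1 :=
              mul_le_mul (hM t) this (Real.exp_pos _).le hM0
          _ = M := mul_one _
      · exact ((hkint x).const_mul M).integrableOn
      · filter_upwards with t
        have : Continuous fun ε : ℝ => ((f t * Real.exp (-(ε * t)) * ker (l * (x - t)) : ℝ) : ℂ) := by
          fun_prop
        have := (this.tendsto 0).mono_left (nhdsWithin_le_nhds (s := Ioi 0))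
        simpa using this
    have hK : IsCompact ((fun q : ℝ × ℝ => (q.1 : ℂ) + I * (l * q.2)) '' (Icc 0 1 ×ˢ Icc (-1) 1)) :=
      (isCompact_Icc.prod isCompact_Icc).image (by fun_prop)
    obtain ⟨B, hB⟩ := hK.exists_bound_of_continuousOn (f := g) (hg.mono (by
      rintro _ ⟨q, hq, rfl⟩
      simpa using hq.1.1))
    have L2 : Tendsto (fun ε : ℝ => ∫ u : ℝ, (tri u : ℂ) * cexp (I * (u * (l * x))) *
        g (ε + I * (l * u))) (𝓝[>] 0)
        (𝓝 (∫ u : ℝ, (tri u : ℂ) * cexp (I * (u * (l * x))) * g (I * (l * u)))) := by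
      apply tendsto_integral_filter_of_dominated_convergence (fun u => |tri u| * B)
      · filter_upwards [self_mem_nhdsWithin] with ε hε
        refine Continuous.aestronglyMeasurable ?_
        have h3 := continuous_tri
        have : Continuous fun u : ℝ => g (ε + I * (l * u)) := by
          refine hg.comp_continuous (by fun_prop) ?_
          intro u; simpa using (le_of_lt hε : (0:ℝ) ≤ ε)
        exact ((continuous_ofReal.comp h3).mul (by fun_prop)).mul this
      · have : Ioo (0:ℝ) 1 ∈ 𝓝[>] (0:ℝ) := Ioo_mem_nhdsGT zero_lt_one
        filter_upwards [this] with ε hε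
        filter_upwards with u
        by_cases hu : u ∈ Ioc (-1:ℝ) 1
        · rw [norm_mul, norm_mul]
          have : ‖cexp (I * (u * (l * x)))‖ = 1 := by
            have := Complex.norm_exp_I_mul_ofReal (u * (l * x))
            push_cast at this; exact this
          rw [this, norm_real, mul_one, Real.norm_eq_abs]
          refine mul_le_mul_of_nonneg_left ?_ (abs_nonneg _)
          exact hB _ ⟨(ε, u), ⟨⟨hε.1.le, hε.2.le⟩, Ioc_subset_Icc_self hu⟩, rfl⟩
        · simp [tri_eq_zero hu]
      · exact ((continuous_tri.integrable_of_hasCompactSupport compactSupport_tri).abs).mul_const B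
      · filter_upwards with u
        refine Tendsto.const_mul _ ?_
        have h0 : ContinuousWithinAt g {w | 0 ≤ w.re} (I * (l * u)) := hg _ (by simp)
        refine h0.tendsto.comp ?_
        refine tendsto_nhdsWithin_iff.2 ⟨?_, ?_⟩
        · have : Continuous fun ε : ℝ => (ε : ℂ) + I * (l * u) := by fun_prop
          have := (this.tendsto 0).mono_left (nhdsWithin_le_nhds (s := Ioi 0))
          simpa using this
        · filter_upwards [self_mem_nhdsWithin] with ε hε
          simpa using (le_of_lt hε : (0:ℝ) ≤ ε)
    have := tendsto_nhds_unique (L1.congr' (by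
      filter_upwards [self_mem_nhdsWithin] with ε hε using key x ε hε)) L2
    rw [← this]; exact integral_complex_ofReal.symm
  -- Riemann-Lebesgue
  have RL := Real.tendsto_integral_exp_smul_cocompact (fun u : ℝ => (tri u : ℂ) * g (I * (l * u)))
  have hT : Tendsto (fun x : ℝ => -(l * x / (2 * Real.pi))) atTop (cocompact ℝ) := by
    refine Tendsto.mono_right ?_ atBot_le_cocompact
    refine tendsto_neg_atTop_atBot.comp ?_
    exact (tendsto_id.const_mul_atTop hl).atTop_div_const (by positivity)
  have h5 := RL.comp hT
  have h6 : Tendsto (fun x : ℝ => ((∫ t in Ioi (0:ℝ), f t * ker (l * (x - t)) : ℝ) : ℂ)) atTop (𝓝 0) := by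
    refine h5.congr fun x => ?_
    rw [lim x]
    refine integral_congr_ae (ae_of_all _ fun u => ?_)
    simp only [Circle.smul_def, Real.fourierChar_apply, smul_eq_mul]
    have : cexp (↑(2 * Real.pi * -(u * -(l * x / (2 * Real.pi)))) * I) = cexp (I * (u * (l * x))) := by
      congr 1
      push_cast
      have : (Real.pi : ℂ) ≠ 0 := by exact_mod_cast Real.pi_ne_zero
      field_simp
    rw [this]; ring
  have := (continuous_re.tendsto 0).comp h6
  simpa [Function.comp_def] using this

end Tauber


namespace Tauber
open MeasureTheory Filter Topology Set

lemma not_large (f : ℝ → ℝ) (hfm : Measurable f) (M : ℝ) (hM : ∀ t, |f t| ≤ M)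
    (hF : ∀ l : ℝ, 0 < l →
      Tendsto (fun x : ℝ => ∫ t in Ioi (0:ℝ), f t * ker (l * (x - t))) atTop (𝓝 0))
    (η h : ℝ) (hη : 0 < η) (hh : 0 < h) :
    ∀ᶠ c in atTop, ¬ ∀ t ∈ Icc (c - h) (c + h), η ≤ f t := by
  have hM0 : 0 ≤ M := (abs_nonneg _).trans (hM 0)
  set J := ∫ y, ker y with hJ
  have hJpos : 0 < J := integral_ker_pos
  have hlim : Tendsto (fun R : ℝ => ∫ y in Icc (-R) R, ker y) atTop (𝓝 J) :=
    (aecover_Icc tendsto_neg_atTop_atBot tendsto_id).integral_tendsto_of_countably_generated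
      integrable_ker
  have hlim2 : Tendsto (fun R : ℝ => η * (∫ y in Icc (-R) R, ker y) -
      M * (J - ∫ y in Icc (-R) R, ker y)) atTop (𝓝 (η * J)) := by
    have := (hlim.const_mul η).sub ((hlim.const_sub J).const_mul M)
    simpa using this
  obtain ⟨R, hR, hR0⟩ := ((hlim2.eventually (lt_mem_nhds (mul_pos hη hJpos))).and
    (eventually_gt_atTop 0)).exists
  set β := η * (∫ y in Icc (-R) R, ker y) - M * (J - ∫ y in Icc (-R) R, ker y) with hβ
  set l := R / h with hl
  have hl0 : 0 < l := div_pos hR0 hh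
  have hβl : 0 < β / l := div_pos hR hl0
  filter_upwards [(hF l hl0).eventually (gt_mem_nhds hβl), eventually_gt_atTop h] with c hc hch hall
  set F : ℝ → ℝ := (Ioi (0:ℝ)).indicator f with hFd
  have hFM : ∀ t, |F t| ≤ M := by
    intro t; rw [hFd, indicator]; split_ifs
    · exact hM t
    · simpa using hM0
  have hFm : Measurable F := hfm.indicator measurableSet_Ioi
  have e1 : ∫ t in Ioi (0:ℝ), f t * ker (l * (c - t)) = ∫ t, F t * ker (l * (c - t)) := by
    rw [← integral_indicator measurableSet_Ioi]
    congr 1; ext t; rw [hFd, indicator_mul_left]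
  have e2 : ∫ t, F t * ker (l * (c - t)) = l⁻¹ * ∫ y, F (c - l⁻¹ * y) * ker y := by
    have a1 := integral_sub_left_eq_self (fun t => F (c - t) * ker (l * t)) volume c
    simp only [sub_sub_cancel] at a1
    have a2 := Measure.integral_comp_mul_left (fun y => F (c - l⁻¹ * y) * ker y) l
    have a3 : ∀ t, l⁻¹ * (l * t) = t := fun t => by field_simp
    simp only [a3] at a2
    rw [a1, a2, abs_of_pos (inv_pos.2 hl0), smul_eq_mul]
  rw [e1, e2] at hc
  have hint : Integrable (fun y => F (c - l⁻¹ * y) * ker y) := by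
    refine integrable_ker.bdd_mul (c := M) ?_ ?_
    · exact (hFm.comp (by fun_prop)).aestronglyMeasurable
    · exact ae_of_all _ fun y => hFM _
  have hsplit := integral_add_compl (s := Icc (-R) R) measurableSet_Icc hint
  have hsplit2 := integral_add_compl (s := Icc (-R) R) measurableSet_Icc integrable_ker
  have b1 : η * (∫ y in Icc (-R) R, ker y) ≤ ∫ y in Icc (-R) R, F (c - l⁻¹ * y) * ker y := by
    rw [← integral_const_mul]
    refine setIntegral_mono_on (integrable_ker.const_mul η).integrableOn hint.integrableOn
      measurableSet_Icc ?_
    intro y hy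
    refine mul_le_mul_of_nonneg_right ?_ (ker_nonneg y)
    have hab : |l⁻¹ * y| ≤ h := by
      rw [abs_mul, abs_of_pos (inv_pos.2 hl0), inv_mul_le_iff₀ hl0, hl, div_mul_cancel₀ _ hh.ne']
      exact abs_le.2 hy
    rw [abs_le] at hab
    have hpos : c - l⁻¹ * y ∈ Ioi (0:ℝ) := by rw [mem_Ioi]; linarith [hab.2]
    rw [hFd, indicator_of_mem hpos]
    exact hall _ ⟨by linarith [hab.2], by linarith [hab.1]⟩
  have b2 : -M * (∫ y in (Icc (-R) R)ᶜ, ker y) ≤ ∫ y in (Icc (-R) R)ᶜ, F (c - l⁻¹ * y) * ker y := by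
    rw [← integral_const_mul]
    refine setIntegral_mono_on (integrable_ker.const_mul _).integrableOn hint.integrableOn
      measurableSet_Icc.compl ?_
    intro y _
    refine mul_le_mul_of_nonneg_right ?_ (ker_nonneg y)
    exact (abs_le.1 (hFM _)).1
  have b3 : β ≤ ∫ y, F (c - l⁻¹ * y) * ker y := by
    rw [← hsplit, hβ]
    have : J - ∫ y in Icc (-R) R, ker y = ∫ y in (Icc (-R) R)ᶜ, ker y := by
      rw [hJ, ← hsplit2]; ring
    rw [this]; linarith
  have := mul_le_mul_of_nonneg_left b3 (inv_pos.2 hl0).le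
  rw [div_eq_inv_mul] at hc
  linarith

/-- Wiener-Ikehara type theorem for bounded slowly decreasing functions. -/
theorem tendsto_zero (f : ℝ → ℝ) (hfm : Measurable f) (M : ℝ) (hM : ∀ t, |f t| ≤ M)
    (hf1 : ∀ t, 0 ≤ f t + 1)
    (hslow : ∀ t h, 0 ≤ t → 0 ≤ h → f t + 1 ≤ (f (t + h) + 1) * Real.exp h)
    (g : ℂ → ℂ) (hg : ContinuousOn g {w | 0 ≤ w.re})
    (hfg : ∀ w : ℂ, 0 < w.re → g w = ∫ t in Ioi (0:ℝ), (f t : ℂ) * Complex.exp (-(w * t))) :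
    Tendsto f atTop (𝓝 0) := by
  have hF := fejer_tendsto f hfm M hM g hg hfg
  have hF' : ∀ l : ℝ, 0 < l →
      Tendsto (fun x : ℝ => ∫ t in Ioi (0:ℝ), (-f t) * ker (l * (x - t))) atTop (𝓝 0) := by
    intro l hl
    have := (hF l hl).neg
    simpa [integral_neg] using this
  rw [Metric.tendsto_nhds]
  intro η hη
  -- choose h
  have hexp : Tendsto (fun h : ℝ => Real.exp (2 * h)) (𝓝[>] 0) (𝓝 1) := by
    have : Continuous fun h : ℝ => Real.exp (2 * h) := by fun_prop
    simpa using (this.tendsto 0).mono_left (nhdsWithin_le_nhds (s := Ioi 0))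
  have t1 : ∀ᶠ h in 𝓝[>] (0:ℝ), (1 + η / 2) * Real.exp (2 * h) < 1 + η := by
    have := hexp.const_mul (1 + η / 2)
    refine this.eventually (gt_mem_nhds ?_); linarith
  have t2 : ∀ᶠ h in 𝓝[>] (0:ℝ), (1 - η) * Real.exp (2 * h) < 1 - η / 2 := by
    have := hexp.const_mul (1 - η)
    refine this.eventually (gt_mem_nhds ?_); linarith
  obtain ⟨h, ⟨h1, h2⟩, hh⟩ := ((t1.and t2).and self_mem_nhdsWithin).exists
  have hh : 0 < h := hh
  have A := not_large f hfm M hM hF (η / 2) h (by linarith) hh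
  have B := not_large (fun t => - f t) hfm.neg M (by simpa using hM) hF' (η / 2) h (by linarith) hh
  have A' := (tendsto_atTop_add_const_right atTop h tendsto_id).eventually A
  have B' := (tendsto_atTop_add_const_right atTop (-h) tendsto_id).eventually B
  filter_upwards [A', B', eventually_ge_atTop (2 * h)] with x hA hB hx
  rw [dist_zero_right, Real.norm_eq_abs, abs_lt]
  constructor
  · by_contra hcon
    push Not at hcon
    apply hB
    intro t ht
    simp only [id] at ht
    have hs := hslow t (x - t) (by linarith [ht.1]) (by linarith [ht.2])
    rw [add_sub_cancel] at hs
    have : Real.exp (x - t) ≤ Real.exp (2 * h) := Real.exp_le_exp.2 (by linarith [ht.1])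
    have h3 : (f x + 1) * Real.exp (x - t) ≤ (f x + 1) * Real.exp (2 * h) :=
      mul_le_mul_of_nonneg_left this (hf1 x)
    have h4 : (f x + 1) * Real.exp (2 * h) ≤ (1 - η) * Real.exp (2 * h) :=
      mul_le_mul_of_nonneg_right (by linarith) (Real.exp_pos _).le
    linarith
  · by_contra hcon
    push Not at hcon
    apply hA
    intro t ht
    simp only [id] at ht
    have hs := hslow x (t - x) (by linarith) (by linarith [ht.1])
    rw [add_sub_cancel] at hs
    have : Real.exp (t - x) ≤ Real.exp (2 * h) := Real.exp_le_exp.2 (by linarith [ht.2])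
    have h3 : (f t + 1) * Real.exp (t - x) ≤ (f t + 1) * Real.exp (2 * h) :=
      mul_le_mul_of_nonneg_left this (hf1 t)
    have h4 : (1 + η / 2) * Real.exp (2 * h) ≤ (f t + 1) * Real.exp (2 * h) := by linarith
    have := le_of_mul_le_mul_right h4 (Real.exp_pos _)
    linarith

end Tauber


namespace BeurlingPNT
open Complex MeasureTheory Filter Topology Set

/-- error term -/
noncomputable def err (a : ℕ → ℝ) (κ : ℝ) : ℝ → ℂ :=
  (Ioi (1:ℝ)).indicator (fun t => (((∑ k ∈ Finset.Icc 1 ⌊t⌋₊, a k) - κ * t : ℝ) : ℂ))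

lemma measurable_err (a : ℕ → ℝ) (κ : ℝ) : Measurable (err a κ) := by
  unfold err
  refine Measurable.indicator ?_ measurableSet_Ioi
  refine Complex.measurable_ofReal.comp ?_
  refine Measurable.sub ?_ (by fun_prop)
  exact (measurable_from_nat (f := fun n => ∑ k ∈ Finset.Icc 1 n, a k)).comp Nat.measurable_floor

lemma err_bound (a : ℕ → ℝ) (κ C δ : ℝ)
    (h : ∀ x : ℝ, 1 ≤ x → |(∑ k ∈ Finset.Icc 1 ⌊x⌋₊, a k) - κ * x| ≤ C * x ^ (1 - δ)) (t : ℝ)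
    (ht : 1 < t) : ‖err a κ t‖ ≤ C * t ^ (1 - δ) := by
  unfold err
  rw [indicator_of_mem (by exact ht), Complex.norm_real]
  exact h t ht.le

lemma locInt_err (a : ℕ → ℝ) (κ C δ : ℝ) (hδ : 0 < δ)
    (h : ∀ x : ℝ, 1 ≤ x → |(∑ k ∈ Finset.Icc 1 ⌊x⌋₊, a k) - κ * x| ≤ C * x ^ (1 - δ)) :
    LocallyIntegrable (err a κ) volume := by
  have hC : 0 ≤ C := by
    have := (abs_nonneg _).trans (h 1 le_rfl)
    simpa using this
  refine LocallyIntegrable.mono (f := fun t : ℝ => C * |t|) ?_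
    (measurable_err a κ).aestronglyMeasurable (Eventually.of_forall fun t => ?_)
  · exact (by fun_prop : Continuous fun t : ℝ => C * |t|).locallyIntegrable
  · by_cases ht : 1 < t
    · refine (err_bound a κ C δ h t ht).trans ?_
      rw [Real.norm_eq_abs, abs_of_nonneg (by positivity), abs_of_pos (by linarith)]
      gcongr
      calc t ^ (1 - δ) ≤ t ^ (1:ℝ) := Real.rpow_le_rpow_of_exponent_le ht.le (by linarith)
        _ = t := Real.rpow_one t
    · unfold err
      rw [indicator_of_notMem (by exact ht)]
      simp only [norm_zero]
      positivity

lemma diff_err (a : ℕ → ℝ) (κ C δ : ℝ) (hδ : 0 < δ)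
    (h : ∀ x : ℝ, 1 ≤ x → |(∑ k ∈ Finset.Icc 1 ⌊x⌋₊, a k) - κ * x| ≤ C * x ^ (1 - δ)) (s : ℂ)
    (hs : 1 - δ < s.re) : DifferentiableAt ℂ (mellin (err a κ)) (-s) := by
  refine mellin_differentiableAt_of_isBigO_rpow (a := δ - 1) (b := (-s).re - 1)
    ((locInt_err a κ C δ hδ h).locallyIntegrableOn _) ?_ (by simp; linarith) ?_ (by linarith)
  · refine Asymptotics.IsBigO.of_bound C ?_
    filter_upwards [eventually_gt_atTop 1] with t ht
    refine (err_bound a κ C δ h t ht).trans ?_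
    rw [Real.norm_eq_abs, abs_of_nonneg (by positivity)]
    simp
  · refine Asymptotics.IsBigO.of_bound 1 ?_
    have : ∀ᶠ t in 𝓝[>] (0:ℝ), t < 1 := by
      exact mem_nhdsWithin_of_mem_nhds (Iio_mem_nhds one_pos)
    filter_upwards [this] with t ht
    unfold err
    rw [indicator_of_notMem (by simp; exact ht.le)]
    simp

lemma sum_isBigO (a : ℕ → ℝ) (ha : ∀ n, 0 ≤ a n) (B : ℝ)
    (h : ∀ x : ℝ, 1 ≤ x → (∑ k ∈ Finset.Icc 1 ⌊x⌋₊, a k) ≤ B * x) :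
    (fun n : ℕ => ∑ k ∈ Finset.Icc 1 n, a k) =O[atTop] fun n => (n:ℝ) ^ (1:ℝ) := by
  refine Asymptotics.IsBigO.of_bound B ?_
  filter_upwards [eventually_ge_atTop 1] with n hn
  rw [Real.norm_eq_abs, abs_of_nonneg (Finset.sum_nonneg fun i _ => ha i)]
  have := h n (by exact_mod_cast hn)
  simpa using this

lemma sum_le_of_err (a : ℕ → ℝ) (κ C δ : ℝ) (hδ : 0 < δ)
    (h : ∀ x : ℝ, 1 ≤ x → |(∑ k ∈ Finset.Icc 1 ⌊x⌋₊, a k) - κ * x| ≤ C * x ^ (1 - δ)) (x : ℝ)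
    (hx : 1 ≤ x) : (∑ k ∈ Finset.Icc 1 ⌊x⌋₊, a k) ≤ (κ + C) * x := by
  have hC : 0 ≤ C := by
    have := (abs_nonneg _).trans (h 1 le_rfl)
    simpa using this
  have h1 := (abs_le.1 (h x hx)).2
  have h2 : C * x ^ (1 - δ) ≤ C * x := by
    gcongr
    calc x ^ (1 - δ) ≤ x ^ (1:ℝ) := Real.rpow_le_rpow_of_exponent_le hx (by linarith)
        _ = x := Real.rpow_one x
  linarith

theorem exists_Z (a : ℕ → ℝ) (ha : ∀ n, 0 ≤ a n) (κ C δ : ℝ) (hδ : 0 < δ)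
    (h : ∀ x : ℝ, 1 ≤ x → |(∑ k ∈ Finset.Icc 1 ⌊x⌋₊, a k) - κ * x| ≤ C * x ^ (1 - δ)) :
    ∃ Z : ℂ → ℂ, DifferentiableOn ℂ Z {s | 1 - δ < s.re} ∧ Z 1 = κ ∧
      ∀ s, 1 < s.re → Z s = (s - 1) * LSeries (fun n => (a n : ℂ)) s := by
  refine ⟨fun s => κ * s + (s - 1) * s * mellin (err a κ) (-s), ?_, by simp, ?_⟩
  · intro s hs
    refine DifferentiableAt.differentiableWithinAt ?_
    have h1 : DifferentiableAt ℂ (fun s => mellin (err a κ) (-s)) s :=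
      DifferentiableAt.comp s (g := mellin (err a κ)) (diff_err a κ C δ hδ h s hs) (by fun_prop)
    fun_prop
  · intro s hs
    have hO := sum_isBigO a ha (κ + C) (sum_le_of_err a κ C δ hδ h)
    rw [LSeries_eq_mul_integral_of_nonneg a zero_le_one hs hO ha]
    have hs1 : s - 1 ≠ 0 := by
      intro h0
      have : s = 1 := by linear_combination h0
      simp [this] at hs
    have hm : MellinConvergent (err a κ) (-s) := by
      refine mellinConvergent_of_isBigO_rpow (a := δ - 1) (b := (-s).re - 1)
        ((locInt_err a κ C δ hδ h).locallyIntegrableOn _) ?_ (by simp; linarith) ?_ (by linarith)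
      · refine Asymptotics.IsBigO.of_bound C ?_
        filter_upwards [eventually_gt_atTop 1] with t ht
        refine (err_bound a κ C δ h t ht).trans ?_
        rw [Real.norm_eq_abs, abs_of_nonneg (by positivity)]
        simp
      · refine Asymptotics.IsBigO.of_bound 1 ?_
        have : ∀ᶠ t in 𝓝[>] (0:ℝ), t < 1 := by
          exact mem_nhdsWithin_of_mem_nhds (Iio_mem_nhds one_pos)
        filter_upwards [this] with t ht
        unfold err
        rw [indicator_of_notMem (by simp; exact ht.le)]
        simp
    have hmel : mellin (err a κ) (-s) = ∫ t in Ioi (1:ℝ), (t:ℂ) ^ (-s-1) * err a κ t := by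
      unfold mellin
      simp only [smul_eq_mul]
      rw [← Set.Ioc_union_Ioi_eq_Ioi (zero_le_one (α := ℝ))]
      rw [setIntegral_union (by exact Ioc_disjoint_Ioi le_rfl) measurableSet_Ioi]
      · rw [setIntegral_eq_zero_of_forall_eq_zero, zero_add]
        intro t ht
        unfold err
        rw [indicator_of_notMem (by simp; exact ht.2)]
        simp
      · exact IntegrableOn.mono_set hm (fun t ht => ht.1)
      · exact IntegrableOn.mono_set hm (fun t ht => lt_trans (zero_lt_one (α := ℝ)) ht)
    have hint : (∫ t in Ioi (1:ℝ), (∑ k ∈ Finset.Icc 1 ⌊t⌋₊, (a k : ℂ)) * (t:ℂ) ^ (-(s+1)))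
        = (∫ t in Ioi (1:ℝ), (t:ℂ) ^ (-s-1) * err a κ t) + κ * ∫ t in Ioi (1:ℝ), (t:ℂ) ^ (-s) := by
      rw [← integral_const_mul, ← integral_add]
      · refine setIntegral_congr_fun measurableSet_Ioi fun t ht => ?_
        have ht0 : (t:ℂ) ≠ 0 := by
          exact_mod_cast (lt_trans zero_lt_one ht).ne'
        unfold err
        rw [indicator_of_mem ht]
        have : (t:ℂ) ^ (-s) = (t:ℂ) ^ (-s-1) * t := by
          rw [cpow_sub _ _ ht0, cpow_one, div_mul_cancel₀ _ ht0]
        simp only [this]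
        push_cast
        rw [show -(s+1) = -s-1 by ring]
        ring
      · exact IntegrableOn.mono_set hm (fun t ht => lt_trans (zero_lt_one (α := ℝ)) ht)
      · exact (integrableOn_Ioi_cpow_of_lt (by simpa using hs) one_pos).const_mul _
    rw [hint, ← hmel, integral_Ioi_cpow_of_lt (by simpa using hs) one_pos]
    have : -s + 1 ≠ 0 := by
      intro h; apply hs1; linear_combination -h
    simp only [ofReal_one, one_cpow]
    field_simp
    ring

end BeurlingPNT


namespace BeurlingPNT
open Complex MeasureTheory Filter Topology Set

lemma tendsto_shift (s₀ : ℂ) : Tendsto (fun ε : ℝ => s₀ + (ε:ℂ)) (𝓝[>] 0) (𝓝[≠] s₀) := by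
  refine tendsto_nhdsWithin_iff.2 ⟨?_, ?_⟩
  · have : Tendsto (fun ε : ℝ => s₀ + (ε:ℂ)) (𝓝 0) (𝓝 (s₀ + ((0:ℝ):ℂ))) := by
      apply Continuous.tendsto; fun_prop
    simpa using this.mono_left nhdsWithin_le_nhds
  · filter_upwards [self_mem_nhdsWithin] with ε hε
    have : (ε:ℂ) ≠ 0 := by exact_mod_cast (ne_of_gt hε)
    simpa using this

lemma order_lemma (Z : ℂ → ℂ) (s₀ : ℂ) (hZ : AnalyticAt ℂ Z s₀)
    (hne : ¬ ∀ᶠ z in 𝓝 s₀, Z z = 0) : ∃ m : ℕ, (Z s₀ = 0 ↔ m ≠ 0) ∧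
      (∀ᶠ ε : ℝ in 𝓝[>] 0, Z (s₀ + ε) ≠ 0) ∧
      Tendsto (fun ε : ℝ => (ε:ℂ) * (deriv Z (s₀ + ε) / Z (s₀ + ε))) (𝓝[>] 0) (𝓝 (m:ℂ)) := by
  have h1 : analyticOrderAt Z s₀ ≠ ⊤ := by
    rwa [Ne, analyticOrderAt_eq_top]
  obtain ⟨g, hg, hg0, hZg⟩ := (hZ.analyticOrderAt_ne_top).1 h1
  set m := analyticOrderNatAt Z s₀ with hm
  refine ⟨m, ?_, ?_, ?_⟩
  · have := hZg.self_of_nhds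
    rw [this]
    by_cases h : m = 0 <;> simp [h, hg0]
  · have h2 : ∀ᶠ z in 𝓝[≠] s₀, Z z ≠ 0 := by
      have := hZ.eventually_eq_zero_or_eventually_ne_zero
      tauto
    exact (tendsto_shift s₀).eventually h2
  · have h3 : ∀ᶠ z in 𝓝[≠] s₀, (z - s₀) * (deriv Z z / Z z) = m + (z - s₀) * (deriv g z / g z) := by
      have e1 := hZg.eventuallyEq_nhds
      have e2 := hg.continuousAt.eventually_ne hg0
      have e3 := hg.eventually_analyticAt
      filter_upwards [e1.filter_mono nhdsWithin_le_nhds, e2.filter_mono nhdsWithin_le_nhds,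
        e3.filter_mono nhdsWithin_le_nhds, self_mem_nhdsWithin] with z h1 h2 h3 h4
      have hz : z - s₀ ≠ 0 := sub_ne_zero.2 h4
      rw [h1.deriv_eq, h1.self_of_nhds]
      simp only [smul_eq_mul]
      have hd : HasDerivAt (fun z => (z - s₀) ^ m * g z)
        ((m * (z - s₀) ^ (m - 1) * 1) * g z + (z - s₀) ^ m * deriv g z) z :=
        (((hasDerivAt_id z).sub_const s₀).pow m).mul h3.differentiableAt.hasDerivAt
      rw [hd.deriv]
      rcases Nat.eq_zero_or_pos m with h | h
      · simp [h]
      · obtain ⟨k, hk⟩ : ∃ k, m = k + 1 := ⟨m - 1, by omega⟩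
        rw [hk]
        simp only [Nat.add_sub_cancel, pow_succ]
        field_simp
    have h4 : Tendsto (fun z => (m:ℂ) + (z - s₀) * (deriv g z / g z)) (𝓝[≠] s₀) (𝓝 m) := by
      have : ContinuousAt (fun z => (m:ℂ) + (z - s₀) * (deriv g z / g z)) s₀ := by
        have c1 := hg.continuousAt
        have c2 := hg.deriv.continuousAt
        exact continuousAt_const.add ((by fun_prop : ContinuousAt (fun z => z - s₀) s₀).mul (c2.div c1 hg0))
      have := this.tendsto
      simp only [sub_self, zero_mul, add_zero] at this
      exact this.mono_left nhdsWithin_le_nhds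
    have h5 := (h4.congr' (h3.mono fun z hz => hz.symm)).comp (tendsto_shift s₀)
    refine h5.congr fun ε => ?_
    simp

lemma three_four_one (Λ : ℕ → ℝ) (hΛ : ∀ n, 0 ≤ Λ n) (σ t : ℝ)
    (h : ∀ s : ℂ, 1 < s.re → LSeriesSummable (fun n => (Λ n : ℂ)) s) (hσ : 1 < σ) :
    0 ≤ (3 * LSeries (fun n => (Λ n : ℂ)) σ + 4 * LSeries (fun n => (Λ n : ℂ)) (σ + t * I) +
      LSeries (fun n => (Λ n : ℂ)) (σ + 2 * t * I)).re := by
  have s1 := h σ (by simpa using hσ)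
  have s2 := h (σ + t * I) (by simpa using hσ)
  have s3 := h (σ + 2 * t * I) (by simpa using hσ)
  have H := ((s1.hasSum.mul_left 3).add (s2.hasSum.mul_left 4)).add s3.hasSum
  have H2 := Complex.hasSum_re H
  unfold LSeries
  rw [← H2.tsum_eq]
  refine tsum_nonneg fun n => ?_
  rcases eq_or_ne n 0 with rfl | hn
  · simp
  · rw [LSeries.term_of_ne_zero hn, LSeries.term_of_ne_zero hn, LSeries.term_of_ne_zero hn]
    have hnp : (0:ℝ) < n := by positivity
    have hn0 : (n:ℂ) ≠ 0 := by exact_mod_cast hn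
    set w : ℂ := (n:ℂ) ^ (-(t * I)) with hw
    have hwn : ‖w‖ = 1 := by
      rw [hw, Complex.norm_natCast_cpow_of_pos (Nat.pos_of_ne_zero hn)]
      simp
    have e2 : (Λ n : ℂ) / (n:ℂ) ^ ((σ:ℂ) + t * I) = ((Λ n / (n:ℝ) ^ σ : ℝ) : ℂ) * w := by
      rw [cpow_add _ _ hn0, hw, cpow_neg]
      push_cast
      rw [Complex.ofReal_cpow hnp.le]
      simp; field_simp
    have e3 : (Λ n : ℂ) / (n:ℂ) ^ ((σ:ℂ) + 2 * t * I) = ((Λ n / (n:ℝ) ^ σ : ℝ) : ℂ) * w^2 := by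
      rw [cpow_add _ _ hn0, hw, ← cpow_nat_mul, mul_assoc, mul_neg, cpow_neg]
      push_cast
      rw [Complex.ofReal_cpow hnp.le]
      simp; field_simp
    have e1 : (Λ n : ℂ) / (n:ℂ) ^ (σ:ℂ) = ((Λ n / (n:ℝ) ^ σ : ℝ) : ℂ) := by
      push_cast
      rw [Complex.ofReal_cpow hnp.le]
      simp
    rw [e1, e2, e3]
    set b : ℝ := Λ n / (n:ℝ) ^ σ
    have hb : 0 ≤ b := div_nonneg (hΛ n) (by positivity)
    have hw2 : w.re ^ 2 + w.im ^ 2 = 1 := by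
      have := Complex.sq_norm w
      rw [hwn, Complex.normSq_apply] at this
      nlinarith
    have : (3 * (b:ℂ) + 4 * (b * w) + b * w ^ 2).re = b * (3 + 4 * w.re + w.re^2 - w.im^2) := by
      simp [pow_two]; ring
    rw [this]
    refine mul_nonneg hb ?_
    nlinarith [sq_nonneg (w.re + 1)]

theorem Z_ne_zero (Λ : ℕ → ℝ) (hΛ : ∀ n, 0 ≤ Λ n)
    (hsum : ∀ s : ℂ, 1 < s.re → LSeriesSummable (fun n => (Λ n : ℂ)) s)
    (hcont : ∀ s : ℂ, 1 < s.re → ContinuousAt (LSeries (fun n => (Λ n : ℂ))) s)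
    (Z : ℂ → ℂ) (δ : ℝ) (hδ : 0 < δ) (hZ : DifferentiableOn ℂ Z {s | 1 - δ < s.re}) (hZ1 : Z 1 ≠ 0)
    (hlog : ∀ s : ℂ, 1 < s.re → (s - 1) * deriv Z s = Z s - (s - 1) * Z s * LSeries (fun n => (Λ n : ℂ)) s)
    (s : ℂ) (hs : 1 ≤ s.re) : Z s ≠ 0 := by
  set D := LSeries (fun n => (Λ n : ℂ)) with hD
  have hopen : IsOpen {s : ℂ | 1 - δ < s.re} := isOpen_lt continuous_const continuous_re
  have hA : AnalyticOnNhd ℂ Z {s | 1 - δ < s.re} := hZ.analyticOnNhd hopen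
  have hnz : ∀ s₀ : ℂ, 1 - δ < s₀.re → ¬ ∀ᶠ z in 𝓝 s₀, Z z = 0 := by
    intro s₀ hs₀ hz
    have := hA.eqOn_zero_of_preconnected_of_eventuallyEq_zero
      (convex_halfSpace_re_gt _).isPreconnected hs₀ hz
    exact hZ1 (this (by simpa using hδ))
  -- general limit
  have key : ∀ s₀ : ℂ, 1 ≤ s₀.re → ∃ m : ℕ, (Z s₀ = 0 ↔ m ≠ 0) ∧
      Tendsto (fun ε : ℝ => (ε:ℂ) * D (s₀ + ε)) (𝓝[>] 0) (𝓝 ((if s₀ = 1 then 1 else 0) - m)) := by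
    intro s₀ hs₀
    obtain ⟨m, h1, h2, h3⟩ := order_lemma Z s₀ (hA s₀ (by show 1 - δ < s₀.re; linarith)) (hnz s₀ (by linarith))
    refine ⟨m, h1, ?_⟩
    have h4 : Tendsto (fun ε : ℝ => (ε:ℂ) / (s₀ + ε - 1)) (𝓝[>] 0) (𝓝 (if s₀ = 1 then 1 else 0)) := by
      split_ifs with h
      · refine tendsto_const_nhds.congr' ?_
        filter_upwards [self_mem_nhdsWithin] with ε hε
        have : (ε:ℂ) ≠ 0 := by exact_mod_cast (ne_of_gt hε)
        rw [h]; simp [this]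
      · have : ContinuousAt (fun ε : ℝ => (ε:ℂ) / (s₀ + ε - 1)) 0 := by
          refine ContinuousAt.div (by fun_prop) (by fun_prop) ?_
          simpa [sub_eq_zero] using h
        have := this.tendsto
        simp only [ofReal_zero, zero_div] at this
        exact this.mono_left nhdsWithin_le_nhds
    refine (h4.sub h3).congr' ?_
    filter_upwards [h2, self_mem_nhdsWithin] with ε hne hε
    have hε : 0 < ε := hε
    have h5 := hlog (s₀ + ε) (by simp; linarith)
    have h6 : s₀ + (ε:ℂ) - 1 ≠ 0 := by
      intro h
      have := congrArg re h
      simp at this; linarith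
    field_simp
    linear_combination (-(ε:ℂ)) * h5
  rcases hs.eq_or_lt with h1 | h1
  · -- boundary
    by_contra hzero
    have hs1 : s ≠ 1 := by rintro rfl; exact hZ1 hzero
    obtain ⟨m, hm, lm⟩ := key s hs
    obtain ⟨k, hk, lk⟩ := key (1 + 2 * s.im * I) (by simp)
    obtain ⟨j, hj, lj⟩ := key 1 (by simp)
    have hj0 : j = 0 := by
      by_contra h; exact hZ1 (hj.2 h)
    have hm0 : 1 ≤ m := Nat.one_le_iff_ne_zero.2 (hm.1 hzero)
    have him : s.im ≠ 0 := by
      intro h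
      apply hs1
      apply Complex.ext <;> simp [← h1, h]
    have h2 : (1 + 2 * s.im * I : ℂ) ≠ 1 := by
      simp [him]
    rw [if_neg hs1] at lm
    rw [if_neg h2] at lk
    rw [if_pos rfl, hj0] at lj
    have L := Complex.continuous_re.continuousAt.tendsto.comp
      (((lj.const_mul 3).add (lm.const_mul 4)).add lk)
    have hnn := ge_of_tendsto L (b := 0) ?_
    · simp at hnn
      have : (1:ℝ) ≤ m := by exact_mod_cast hm0
      have : (0:ℝ) ≤ k := by positivity
      linarith
    · filter_upwards [self_mem_nhdsWithin] with ε hε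
      have hε : 0 < ε := hε
      have := three_four_one Λ hΛ (1 + ε) s.im hsum (by linarith)
      have e : s = 1 + s.im * I := by
        apply Complex.ext <;> simp [← h1]
      simp only [Function.comp]
      have e1 : ((1 + ε : ℝ) : ℂ) + s.im * I = s + ε := by
        conv_rhs => rw [e]
        push_cast; ring
      have e2 : ((1 + ε : ℝ) : ℂ) + 2 * s.im * I = 1 + 2 * s.im * I + ε := by
        push_cast; ring
      have e3 : ((1 + ε : ℝ) : ℂ) = 1 + ε := by push_cast; ring
      rw [e1, e2, e3] at this
      have e4 : 3 * ((ε:ℂ) * D (1 + ε)) + 4 * (ε * D (s + ε)) + ε * D (1 + 2 * s.im * I + ε)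
        = ε * (3 * D (1 + ε) + 4 * D (s + ε) + D (1 + 2 * s.im * I + ε)) := by ring
      rw [e4, Complex.re_ofReal_mul]
      exact mul_nonneg hε.le this
  · obtain ⟨m, hm, lm⟩ := key s hs
    have hs1 : s ≠ 1 := by rintro rfl; simp at h1
    rw [if_neg hs1] at lm
    have h0 : Tendsto (fun ε : ℝ => (ε:ℂ) * D (s + ε)) (𝓝[>] 0) (𝓝 0) := by
      have : ContinuousAt (fun ε : ℝ => (ε:ℂ) * D (s + ε)) 0 := by
        refine ContinuousAt.mul (by fun_prop) ?_
        refine ContinuousAt.comp (g := D) ?_ (by fun_prop)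
        simpa using hcont s h1
      have := this.tendsto
      simp only [ofReal_zero, zero_mul] at this
      exact this.mono_left nhdsWithin_le_nhds
    have := tendsto_nhds_unique lm h0
    simp at this
    rw [Ne, hm]
    simpa using this

end BeurlingPNT


namespace BeurlingPNT
open Complex MeasureTheory Filter Topology Set

lemma absc_le (a : ℕ → ℝ) (ha : ∀ n, 0 ≤ a n) (B : ℝ)
    (h : ∀ x : ℝ, 1 ≤ x → (∑ k ∈ Finset.Icc 1 ⌊x⌋₊, a k) ≤ B * x) :
    LSeries.abscissaOfAbsConv (fun n => (a n : ℂ)) ≤ (1:ℝ) := by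
  refine LSeries.abscissaOfAbsConv_le_of_forall_lt_LSeriesSummable fun y hy => ?_
  exact LSeriesSummable_of_sum_norm_bigO_and_nonneg (sum_isBigO a ha B h) ha zero_le_one (by simpa using hy)

lemma summ (a : ℕ → ℝ) (ha : ∀ n, 0 ≤ a n) (B : ℝ)
    (h : ∀ x : ℝ, 1 ≤ x → (∑ k ∈ Finset.Icc 1 ⌊x⌋₊, a k) ≤ B * x) (s : ℂ) (hs : 1 < s.re) :
    LSeriesSummable (fun n => (a n : ℂ)) s :=
  LSeriesSummable_of_sum_norm_bigO_and_nonneg (sum_isBigO a ha B h) ha zero_le_one hs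

theorem pnt (a Λ : ℕ → ℝ) (ha : ∀ n, 0 ≤ a n) (hΛ : ∀ n, 0 ≤ Λ n) (κ C δ B : ℝ) (hκ : 0 < κ)
    (hδ : 0 < δ)
    (h : ∀ x : ℝ, 1 ≤ x → |(∑ k ∈ Finset.Icc 1 ⌊x⌋₊, a k) - κ * x| ≤ C * x ^ (1 - δ))
    (hB : ∀ x : ℝ, 1 ≤ x → (∑ k ∈ Finset.Icc 1 ⌊x⌋₊, Λ k) ≤ B * x)
    (hconv : ∀ n ≠ 0, LSeries.convolution (fun n => (a n : ℂ)) (fun n => (Λ n : ℂ)) n =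
      LSeries.logMul (fun n => (a n : ℂ)) n) :
    Tendsto (fun x : ℝ => (∑ k ∈ Finset.Icc 1 ⌊x⌋₊, Λ k) / x) atTop (𝓝 1) := by
  set D := LSeries (fun n => (Λ n : ℂ)) with hD
  set ζ := LSeries (fun n => (a n : ℂ)) with hζ
  obtain ⟨Z, hZd, hZ1, hZζ⟩ := exists_Z a ha κ C δ hδ h
  have hac := absc_le a ha (κ + C) (sum_le_of_err a κ C δ hδ h)
  have hlt : ∀ s : ℂ, 1 < s.re → LSeries.abscissaOfAbsConv (fun n => (a n : ℂ)) < s.re := fun s hs =>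
    lt_of_le_of_lt hac (by exact_mod_cast hs)
  have hltΛ : ∀ s : ℂ, 1 < s.re → LSeries.abscissaOfAbsConv (fun n => (Λ n : ℂ)) < s.re := fun s hs =>
    lt_of_le_of_lt (absc_le Λ hΛ B hB) (by exact_mod_cast hs)
  have hlog : ∀ s : ℂ, 1 < s.re → (s - 1) * deriv Z s = Z s - (s - 1) * Z s * D s := by
    intro s hs
    have hopen : IsOpen {s : ℂ | 1 < s.re} := isOpen_lt continuous_const continuous_re
    have e : Z =ᶠ[𝓝 s] fun s => (s - 1) * ζ s := by
      filter_upwards [hopen.mem_nhds hs] with z hz using hZζ z hz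
    have hd := ((hasDerivAt_id s).sub_const 1).mul (LSeries_hasDerivAt (hlt s hs))
    have e2 : deriv Z s = _ := e.deriv_eq.trans hd.deriv
    have e3 : LSeries (LSeries.logMul fun n => (a n : ℂ)) s = ζ s * D s := by
      rw [← LSeries_convolution' (summ a ha _ (sum_le_of_err a κ C δ hδ h) s hs) (summ Λ hΛ B hB s hs)]
      exact LSeries_congr (fun {n} hn => (hconv n hn).symm) s
    rw [e2, e3, hZζ s hs]
    simp only [id]
    ring
  have hne := Z_ne_zero Λ hΛ (summ Λ hΛ B hB)
    (fun s hs => ((LSeries_analyticOnNhd _ s (hltΛ s hs)).continuousAt)) Z δ hδ hZd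
    (by rw [hZ1]; exact_mod_cast hκ.ne') hlog
  set ψ : ℝ → ℝ := fun x => ∑ k ∈ Finset.Icc 1 ⌊x⌋₊, Λ k with hψ
  have hψ0 : ∀ x, 0 ≤ ψ x := fun x => Finset.sum_nonneg fun i _ => hΛ i
  have hψm : Monotone ψ := by
    intro x y hxy
    refine Finset.sum_le_sum_of_subset_of_nonneg ?_ (fun i _ _ => hΛ i)
    exact Finset.Icc_subset_Icc le_rfl (Nat.floor_mono hxy)
  have hB0 : 0 ≤ B := by
    have := (hψ0 1).trans (hB 1 le_rfl); simpa using this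
  have hψb : ∀ t : ℝ, ψ (Real.exp t) * Real.exp (-t) ≤ B := by
    intro t
    rcases le_or_gt 0 t with ht | ht
    · have := hB (Real.exp t) (Real.one_le_exp ht)
      rw [Real.exp_neg, ← div_eq_mul_inv, div_le_iff₀ (Real.exp_pos t)]
      exact this
    · have : ψ (Real.exp t) = 0 := by
        simp only [hψ]
        rw [Nat.floor_eq_zero.2 (by rw [← Real.exp_zero]; exact Real.exp_lt_exp.2 ht)]
        simp
      rw [this]; simpa using hB0
  have hψnn : ∀ t : ℝ, 0 ≤ ψ (Real.exp t) * Real.exp (-t) := fun t =>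
    mul_nonneg (hψ0 _) (Real.exp_pos _).le
  have hmeas : Measurable fun t : ℝ => ψ (Real.exp t) * Real.exp (-t) := by
    refine Measurable.mul (hψm.measurable.comp Real.measurable_exp) (by fun_prop)
  have key := Tauber.tendsto_zero (fun t => ψ (Real.exp t) * Real.exp (-t) - 1)
    (hmeas.sub_const 1) (B + 1) (fun t => by
      rw [abs_le]; constructor <;> linarith [hψb t, hψnn t])
    (fun t => by linarith [hψnn t])
    (fun t h ht hh => by
      simp only [sub_add_cancel]
      have : Real.exp (-(t + h)) * Real.exp h = Real.exp (-t) := by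
        rw [← Real.exp_add]; congr 1; ring
      rw [mul_assoc, this]
      gcongr
      exact hψm (Real.exp_le_exp.2 (by linarith)))
    (fun w => (- 1 - deriv Z (1 + w) / Z (1 + w)) / (1 + w)) ?_ ?_
  · have k2 : Tendsto (fun t : ℝ => ψ (Real.exp t) * Real.exp (-t)) atTop (𝓝 1) := by
      have := key.add_const 1
      simpa using this
    have k3 := k2.comp Real.tendsto_log_atTop
    refine k3.congr' ?_
    filter_upwards [eventually_gt_atTop 0] with x hx
    simp only [Function.comp]
    rw [Real.exp_neg, Real.exp_log hx, div_eq_mul_inv]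
  · have hA : AnalyticOnNhd ℂ Z {s | 1 - δ < s.re} :=
      hZd.analyticOnNhd (isOpen_lt continuous_const continuous_re)
    have hmaps : MapsTo (fun w : ℂ => 1 + w) {w | 0 ≤ w.re} {s | 1 - δ < s.re} := by
      intro w hw
      have : 0 ≤ w.re := hw
      simp; linarith
    have c1 : ContinuousOn (fun w : ℂ => Z (1 + w)) {w | 0 ≤ w.re} :=
      hA.continuousOn.comp (by fun_prop) hmaps
    have c2 : ContinuousOn (fun w : ℂ => deriv Z (1 + w)) {w | 0 ≤ w.re} :=
      hA.deriv.continuousOn.comp (by fun_prop) hmaps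
    refine ContinuousOn.div (continuousOn_const.sub (c2.div c1 ?_)) (by fun_prop) ?_
    · intro w hw
      have : 0 ≤ w.re := hw
      exact hne _ (by simpa using this)
    · intro w hw h0
      have : 0 ≤ w.re := hw
      have := congrArg re h0
      simp at this; linarith
  · intro w hw
    have hs : 1 < (1 + w).re := by simpa using hw
    have hDint := LSeries_eq_mul_integral_of_nonneg Λ zero_le_one hs (sum_isBigO Λ hΛ B hB) hΛ
    have himg : Real.exp '' (Ioi 0) = Ioi (1:ℝ) := by
      ext x; constructor
      · rintro ⟨t, ht, rfl⟩; exact Real.one_lt_exp_iff.2 ht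
      · intro hx
        exact ⟨Real.log x, Real.log_pos hx, Real.exp_log (lt_trans one_pos hx)⟩
    rw [← himg, integral_image_eq_integral_abs_deriv_smul measurableSet_Ioi
      (fun t _ => (Real.hasDerivAt_exp t).hasDerivWithinAt) Real.exp_injective.injOn] at hDint
    have hexp : IntegrableOn (fun t : ℝ => Complex.exp (-(w * t))) (Ioi 0) := by
      have := integrableOn_exp_mul_complex_Ioi (a := -w) (by simpa using hw) 0
      simpa using this
    have hexpi : ∫ t in Ioi (0:ℝ), Complex.exp (-(w * t)) = 1 / w := by
      have := integral_exp_mul_complex_Ioi (a := -w) (by simpa using hw) 0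
      simpa using this
    have hw0 : w ≠ 0 := by rintro rfl; simp at hw
    have hs0 : (1 + w) ≠ 0 := by
      intro h0
      have := congrArg re h0
      simp at this; linarith
    have hi : (∫ t in Ioi (0:ℝ), (((ψ (Real.exp t) * Real.exp (-t) - 1 : ℝ)) : ℂ) * Complex.exp (-(w * t)))
        = (∫ t in Ioi (0:ℝ), (((ψ (Real.exp t) * Real.exp (-t) : ℝ)) : ℂ) * Complex.exp (-(w * t))) -
          ∫ t in Ioi (0:ℝ), Complex.exp (-(w * t)) := by
      rw [← integral_sub]
      · congr 1; ext t; push_cast; ring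
      · refine Integrable.bdd_mul (c := B) hexp ?_ ?_
        · exact (Complex.measurable_ofReal.comp hmeas).aestronglyMeasurable
        · refine Eventually.of_forall fun t => ?_
          rw [Complex.norm_real, Real.norm_of_nonneg (hψnn t)]
          exact hψb t
      · exact hexp
    rw [hi, hexpi]
    have hD2 : D (1 + w) = (1 + w) * ∫ t in Ioi (0:ℝ), (((ψ (Real.exp t) * Real.exp (-t) : ℝ)) : ℂ) * Complex.exp (-(w * t)) := by
      rw [hD, hDint]
      congr 1
      refine setIntegral_congr_fun measurableSet_Ioi fun t ht => ?_
      simp only [hψ, abs_of_pos (Real.exp_pos t)]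
      rw [cpow_def_of_ne_zero (by exact_mod_cast (Real.exp_pos t).ne'),
        ← Complex.ofReal_log (Real.exp_pos t).le, Real.log_exp, Complex.real_smul]
      push_cast
      have : Complex.exp (t * -(1 + w + 1)) = Complex.exp (-t) * Complex.exp (-t) * Complex.exp (-(w * t)) := by
        rw [← Complex.exp_add, ← Complex.exp_add]; congr 1; ring
      have h2 : Complex.exp t * Complex.exp (-t) = 1 := by
        rw [← Complex.exp_add]; simp
      rw [this]
      linear_combination ((∑ k ∈ Finset.Icc 1 ⌊Real.exp t⌋₊, (Λ k : ℂ)) * Complex.exp (-t) * Complex.exp (-(w * t))) * h2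
    have hl := hlog (1 + w) hs
    have hz := hne (1 + w) hs.le
    rw [eq_sub_iff_add_eq, ← mul_right_inj' hs0, ← hD2]
    simp only [add_sub_cancel_left] at hl
    field_simp
    linear_combination -hl

end BeurlingPNT


namespace IdealVM
open Ideal

variable (K : Type*) [Field K] [NumberField K]

open NumberField

open Classical in
/-- von Mangoldt function on ideals -/
noncomputable def vM {K : Type*} [Field K] [NumberField K] (J : Ideal (𝓞 K)) : ℝ :=
  if h : IsPrimePow J then Real.log (absNorm (Classical.choose h)) else 0

variable {K}

lemma prime_eq_of_dvd {P Q : Ideal (𝓞 K)} (hP : Prime P) (hQ : Prime Q) (h : P ∣ Q) : P = Q := by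
  have := hP.associated_of_dvd hQ h
  exact associated_iff_eq.1 this

lemma prime_pow_inj {P Q : Ideal (𝓞 K)} (hP : Prime P) (hQ : Prime Q) {k l : ℕ} (hk : 0 < k)
    (h : P ^ k = Q ^ l) : P = Q := by
  have h1 : P ∣ Q ^ l := h ▸ dvd_pow_self P hk.ne'
  exact prime_eq_of_dvd hP hQ (hP.dvd_of_dvd_pow h1)

lemma vM_pow {P : Ideal (𝓞 K)} (hP : Prime P) {k : ℕ} (hk : 0 < k) :
    vM (P ^ k) = Real.log (absNorm P) := by
  have h : IsPrimePow (P ^ k) := ⟨P, k, hP, hk, rfl⟩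
  unfold vM
  rw [dif_pos h]
  obtain ⟨l, hQ, hl, hlk⟩ := Classical.choose_spec h
  rw [← prime_pow_inj hP hQ hk hlk.symm]

lemma vM_prime {P : Ideal (𝓞 K)} (hP : Prime P) : vM P = Real.log (absNorm P) := by
  simpa using vM_pow hP one_pos

lemma vM_nonneg (J : Ideal (𝓞 K)) : 0 ≤ vM J := by
  unfold vM
  split_ifs with h
  · exact Real.log_natCast_nonneg _
  · exact le_rfl

lemma finite_dvd {I : Ideal (𝓞 K)} (hI : I ≠ 0) : {J : Ideal (𝓞 K) | J ∣ I}.Finite := by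
  classical
  have := UniqueFactorizationMonoid.fintypeSubtypeDvd I hI
  exact Set.finite_coe_iff.1 (Finite.of_fintype {J // J ∣ I})

lemma two_le_norm {P : Ideal (𝓞 K)} (hP : Prime P) : 2 ≤ absNorm P := by
  have h0 : absNorm P ≠ 0 := fun h => hP.ne_zero (absNorm_eq_zero_iff.1 h)
  have h1 : absNorm P ≠ 1 := fun h => hP.not_isUnit (by
    rw [absNorm_eq_one_iff] at h; rw [h, ← one_eq_top]; exact isUnit_one)
  omega

lemma finsum_vM {I : Ideal (𝓞 K)} (hI : I ≠ 0) :
    ∑ J ∈ (finite_dvd hI).toFinset, vM J = Real.log (absNorm I) := by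
  classical
  induction I using UniqueFactorizationMonoid.induction_on_prime with
  | h₁ => exact absurd rfl hI
  | h₂ x hx =>
    have hx1 : x = 1 := isUnit_iff_eq_one.1 hx
    subst hx1
    rw [map_one, Nat.cast_one, Real.log_one]
    refine Finset.sum_eq_zero fun J hJ => ?_
    rw [Set.Finite.mem_toFinset] at hJ
    have : J ∣ 1 := by simpa [one_eq_top] using hJ
    unfold vM
    rw [dif_neg]
    intro h
    exact h.not_unit (isUnit_of_dvd_one this)
  | h₃ I P hI0 hP ih =>
    have ih := ih hI0
    obtain ⟨v, hv1, hv2⟩ : ∃ v, P ^ v ∣ I ∧ ¬ P ^ (v + 1) ∣ I := by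
      have := FiniteMultiplicity.of_prime_left hP hI0
      exact this.exists_eq_pow_mul_and_not_dvd.elim fun c hc =>
        ⟨multiplicity P I, pow_multiplicity_dvd P I, this.not_pow_dvd_of_multiplicity_lt (Nat.lt_succ_self _)⟩
    rw [map_mul, Nat.cast_mul, Real.log_mul, ← ih]
    · have hnot : P ^ (v + 1) ∉ (finite_dvd hI0).toFinset := by
        rw [Set.Finite.mem_toFinset]; exact hv2
      have h2 : ∑ J ∈ insert (P ^ (v + 1)) (finite_dvd hI0).toFinset, vM J
          = ∑ J ∈ (finite_dvd hI).toFinset, vM J := by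
        refine Finset.sum_subset ?_ ?_
        · intro J hJ
          rw [Set.Finite.mem_toFinset]
          rw [Finset.mem_insert, Set.Finite.mem_toFinset] at hJ
          rcases hJ with rfl | hJ
          · rw [Set.mem_setOf_eq]
            rw [pow_succ']
            exact mul_dvd_mul_left _ hv1
          · exact Dvd.dvd.mul_left hJ _
        · intro J hJ hJ2
          unfold vM
          rw [dif_neg]
          rintro ⟨Q, k, hQ, hk, rfl⟩
          rw [Set.Finite.mem_toFinset] at hJ
          rw [Finset.mem_insert, Set.Finite.mem_toFinset, not_or] at hJ2
          have hJ : Q ^ k ∣ P * I := hJ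
          have hJ3 : ¬ Q ^ k ∣ I := hJ2.2
          by_cases hPQ : Q = P
          · subst hPQ
            have hk1 : v < k := by
              by_contra hh
              exact hJ3 ((pow_dvd_pow _ (not_lt.1 hh)).trans hv1)
            have hk2 : k ≤ v + 1 := by
              by_contra hh
              have h3 : Q * Q ^ (v + 1) ∣ Q * I := by
                rw [← pow_succ']
                exact (pow_dvd_pow _ (by omega)).trans hJ
              exact hv2 ((mul_dvd_mul_iff_left hQ.ne_zero).1 h3)
            exact hJ2.1 (by congr 1; omega)
          · have : ¬ Q ∣ P := fun h => hPQ (prime_eq_of_dvd hQ hP h)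
            exact hJ3 (hQ.pow_dvd_of_dvd_mul_left k this hJ)
      rw [← h2, Finset.sum_insert hnot, vM_pow hP (Nat.succ_pos v)]
    · have := two_le_norm hP
      exact_mod_cast (by omega : absNorm P ≠ 0)
    · exact_mod_cast fun h => hI0 (absNorm_eq_zero_iff.1 h)

end IdealVM


namespace IdealVM
open Ideal NumberField

variable (K : Type*) [Field K] [NumberField K]

/-- ideals of norm n -/
noncomputable def F (n : ℕ) : Finset (Ideal (𝓞 K)) := (Ideal.finite_setOfPred_absNorm_eq n).toFinset

variable {K} in
lemma mem_F {n : ℕ} {I : Ideal (𝓞 K)} : I ∈ F K n ↔ absNorm I = n := by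
  unfold F; rw [Set.Finite.mem_toFinset]; rfl

/-- number of ideals of norm n -/
noncomputable def aK (n : ℕ) : ℝ := (F K n).card

/-- von Mangoldt coefficients -/
noncomputable def LK (n : ℕ) : ℝ := ∑ J ∈ F K n, vM J

lemma aK_nonneg (n : ℕ) : 0 ≤ aK K n := by unfold aK; positivity

lemma LK_nonneg (n : ℕ) : 0 ≤ LK K n := Finset.sum_nonneg fun J _ => vM_nonneg J

lemma ne_zero_of_mem_F {n : ℕ} (hn : n ≠ 0) {I : Ideal (𝓞 K)} (h : I ∈ F K n) : I ≠ 0 := by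
  rintro rfl
  rw [mem_F] at h
  simp at h
  exact hn h.symm

lemma conv_real (n : ℕ) (hn : n ≠ 0) :
    ∑ p ∈ n.divisorsAntidiagonal, aK K p.1 * LK K p.2 = Real.log n * aK K n := by
  classical
  have h1 : ∀ p ∈ n.divisorsAntidiagonal, aK K p.1 * LK K p.2
      = ∑ x ∈ F K p.1 ×ˢ F K p.2, vM x.2 := by
    intro p _
    rw [Finset.sum_product]
    simp [aK, LK]
  rw [Finset.sum_congr rfl h1, Finset.sum_sigma']
  have h2 : Real.log n * aK K n = ∑ I ∈ (F K n).attach,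
      ∑ J ∈ (finite_dvd (ne_zero_of_mem_F K hn I.2)).toFinset, vM J := by
    have : ∀ I ∈ (F K n).attach,
      ∑ J ∈ (finite_dvd (ne_zero_of_mem_F K hn I.2)).toFinset, vM J = Real.log n := by
      intro I _
      rw [finsum_vM (ne_zero_of_mem_F K hn I.2), mem_F.1 I.2]
    rw [Finset.sum_congr rfl this]
    simp [aK, mul_comm]
  rw [h2, Finset.sum_sigma']
  refine Finset.sum_bij (fun x hx => ⟨⟨x.2.1 * x.2.2, ?_⟩, x.2.2⟩) ?_ ?_ ?_ ?_
  · simp only [Finset.mem_sigma, Finset.mem_product, mem_F, Nat.mem_divisorsAntidiagonal] at hx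
    rw [mem_F, map_mul, hx.2.1, hx.2.2, hx.1.1]
  · intro x hx
    simp only [Finset.mem_sigma, Finset.mem_attach, true_and, Set.Finite.mem_toFinset]
    exact dvd_mul_left _ _
  · rintro ⟨⟨d, e⟩, ⟨I, J⟩⟩ hx ⟨⟨d', e'⟩, ⟨I', J'⟩⟩ hx' h
    simp only [Finset.mem_sigma, Finset.mem_product, mem_F, Nat.mem_divisorsAntidiagonal] at hx hx'
    simp only [Sigma.mk.injEq, Subtype.mk.injEq, heq_eq_eq] at h
    obtain ⟨h1, rfl⟩ := h
    have hJ : J ≠ 0 := by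
      rintro rfl
      have := hx.2.2
      simp at this
      rw [← this, mul_zero] at hx
      exact hn hx.1.1.symm
    have := mul_right_cancel₀ hJ h1
    subst this
    rw [← hx.2.1, ← hx.2.2, ← hx'.2.1, ← hx'.2.2]
  · rintro ⟨⟨I, hI⟩, J⟩ hx
    simp only [Finset.mem_sigma, Finset.mem_attach, true_and, Set.Finite.mem_toFinset] at hx
    obtain ⟨I', hI'⟩ : J ∣ I := hx
    refine ⟨⟨⟨absNorm I', absNorm J⟩, ⟨I', J⟩⟩, ?_, ?_⟩
    · simp only [Finset.mem_sigma, Finset.mem_product, mem_F, Nat.mem_divisorsAntidiagonal,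
        and_self, and_true]
      rw [mem_F] at hI
      exact ⟨by rw [← hI, hI', map_mul, mul_comm], hn⟩
    · subst hI'
      simp [mul_comm]
  · intro x hx; rfl

lemma conv (n : ℕ) (hn : n ≠ 0) :
    LSeries.convolution (fun n => (aK K n : ℂ)) (fun n => (LK K n : ℂ)) n =
      LSeries.logMul (fun n => (aK K n : ℂ)) n := by
  rw [LSeries.convolution_def]
  unfold LSeries.logMul
  have := congrArg (fun x : ℝ => (x : ℂ)) (conv_real K n hn)
  push_cast at this
  exact this

lemma LK_le (n : ℕ) : LK K n ≤ Module.finrank ℚ K * ArithmeticFunction.vonMangoldt n := by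
  classical
  by_cases hn : IsPrimePow n
  · obtain ⟨p, j, hp, hj, rfl⟩ := hn
    have hp := hp.nat_prime
    rw [ArithmeticFunction.vonMangoldt_apply_pow hj.ne', ArithmeticFunction.vonMangoldt_apply_prime hp]
    have hp0 : (p : 𝓞 K) ≠ 0 := by exact_mod_cast hp.ne_zero
    have hspan : span {(p : 𝓞 K)} ≠ 0 := by
      rw [Ne, Submodule.zero_eq_bot, span_singleton_eq_bot]; exact hp0
    have hlog : Module.finrank ℚ K * Real.log p = Real.log (absNorm (span {(p : 𝓞 K)})) := by
      rw [absNorm_span_singleton]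
      have : (p : 𝓞 K) = algebraMap ℤ (𝓞 K) (p:ℤ) := by simp
      rw [this, Algebra.norm_algebraMap, RingOfIntegers.rank]
      simp [Int.natAbs_pow]
    rw [hlog, ← finsum_vM hspan]
    -- sum over prime powers
    have hsp : ∀ J ∈ F K (p ^ j), IsPrimePow J → ∃ P k, Prime P ∧ 0 < k ∧ P ^ k = J := by
      rintro J _ ⟨P, k, h⟩; exact ⟨P, k, h⟩
    have e1 : LK K (p ^ j) = ∑ J ∈ (F K (p ^ j)).filter IsPrimePow, vM J := by
      unfold LK
      rw [Finset.sum_filter]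
      refine Finset.sum_congr rfl fun J _ => ?_
      split_ifs with h
      · rfl
      · unfold vM; rw [dif_neg h]
    rw [e1]
    have hbase : ∀ J ∈ (F K (p ^ j)).filter IsPrimePow, ∃ P : Ideal (𝓞 K), Prime P ∧ P ∣ span {(p : 𝓞 K)} ∧
        ∃ k, 0 < k ∧ P ^ k = J := by
      intro J hJ
      rw [Finset.mem_filter, mem_F] at hJ
      obtain ⟨hJn, P, k, hP, hk, rfl⟩ := hJ
      refine ⟨P, hP, ?_, k, hk, rfl⟩
      rw [dvd_span_singleton]
      have h1 := absNorm_mem (P ^ k)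
      rw [hJn] at h1
      have h2 : (p : 𝓞 K) ^ j ∈ P := by
        have := pow_le_self hk.ne' h1
        simpa using this
      have : P.IsPrime := isPrime_of_prime hP
      exact this.mem_of_pow_mem _ h2
    choose! g hg1 hg2 hg3 using hbase
    calc ∑ J ∈ (F K (p ^ j)).filter IsPrimePow, vM J
        = ∑ J ∈ (F K (p ^ j)).filter IsPrimePow, vM (g J) := by
          refine Finset.sum_congr rfl fun J hJ => ?_
          obtain ⟨k, hk, h⟩ := hg3 J hJ
          conv_lhs => rw [← h]
          rw [vM_pow (hg1 J hJ) hk, vM_prime (hg1 J hJ)]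
      _ = ∑ P ∈ ((F K (p ^ j)).filter IsPrimePow).image g, vM P := by
          rw [Finset.sum_image]
          intro J hJ J' hJ' hh
          obtain ⟨k, hk, h⟩ := hg3 J hJ
          obtain ⟨k', hk', h'⟩ := hg3 J' hJ'
          have n1 := mem_F.1 (Finset.mem_filter.1 hJ).1
          have n2 := mem_F.1 (Finset.mem_filter.1 hJ').1
          rw [← h, map_pow] at n1
          rw [← h', ← hh, map_pow] at n2
          have : k = k' := Nat.pow_right_injective (two_le_norm (hg1 J hJ)) (n1.trans n2.symm)
          rw [← h, ← h', ← hh, this]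
      _ ≤ _ := by
          refine Finset.sum_le_sum_of_subset_of_nonneg ?_ (fun i _ _ => vM_nonneg i)
          intro P hP
          obtain ⟨J, hJ, rfl⟩ := Finset.mem_image.1 hP
          rw [Set.Finite.mem_toFinset]
          exact hg2 J hJ
  · have : LK K n = 0 := by
      refine Finset.sum_eq_zero fun J hJ => ?_
      unfold vM
      rw [dif_neg]
      rintro ⟨P, k, hP, hk, rfl⟩
      apply hn
      rw [mem_F, map_pow] at hJ
      rw [← hJ]
      have hPp : P.IsPrime := isPrime_of_prime hP
      have hPm : P.IsMaximal := hPp.isMaximal hP.ne_zero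
      have h2 := two_le_norm hP
      rw [absNorm_apply, Submodule.cardQuot_apply] at h2 ⊢
      have : Finite (𝓞 K ⧸ P) := Nat.finite_of_card_ne_zero (by omega)
      let _ := Fintype.ofFinite (𝓞 K ⧸ P)
      let _ := Ideal.Quotient.field P
      rw [Nat.card_eq_fintype_card]
      have := FiniteField.isPrimePow_card (𝓞 K ⧸ P)
      exact this.pow hk.ne'
    rw [this, ArithmeticFunction.vonMangoldt_eq_zero_iff.2 hn, mul_zero]

lemma LK_prime (p : ℕ) (hp : p.Prime) : LK K p = aK K p * Real.log p := by
  unfold LK aK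
  rw [Finset.sum_congr rfl (g := fun _ => Real.log p)]
  · simp
  · intro J hJ
    have hJ0 := ne_zero_of_mem_F K hp.ne_zero hJ
    rw [mem_F] at hJ
    have : J.IsPrime := isPrime_of_irreducible_absNorm (by rw [hJ]; exact hp)
    rw [vM_prime (prime_of_isPrime hJ0 this), hJ]

lemma aK_prime (p : ℕ) (hp : p.Prime) : aK K p = Nat.card (𝓞 K →+* ZMod p) := by
  have := Fact.mk hp
  unfold aK
  rw [← Nat.card_eq_finsetCard]
  congr 1
  symm
  refine Nat.card_congr (Equiv.ofBijective (fun φ => ⟨RingHom.ker φ, ?_⟩) ⟨?_, ?_⟩)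
  · rw [mem_F, absNorm_apply, Submodule.cardQuot_apply]
    have := Nat.card_congr (RingHom.quotientKerEquivOfSurjective (ZMod.ringHom_surjective φ)).toEquiv
    rw [this, Nat.card_zmod]
  · intro φ ψ h
    simp only [Subtype.mk.injEq] at h
    ext x
    obtain ⟨n, hn⟩ := ZMod.intCast_surjective (φ x)
    have h1 : x - (n : 𝓞 K) ∈ RingHom.ker φ := by
      rw [RingHom.mem_ker, map_sub, map_intCast, hn, sub_self]
    rw [h, RingHom.mem_ker, map_sub, map_intCast, hn, sub_eq_zero] at h1
    exact h1.symm
  · rintro ⟨I, hI⟩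
    rw [mem_F, absNorm_apply, Submodule.cardQuot_apply] at hI
    have : Finite (𝓞 K ⧸ I) := Nat.finite_of_card_ne_zero (by rw [hI]; exact hp.ne_zero)
    have := Fintype.ofFinite (𝓞 K ⧸ I)
    rw [Nat.card_eq_fintype_card] at hI
    refine ⟨((ZMod.ringEquivOfPrime _ hp hI).symm : (𝓞 K ⧸ I) →+* ZMod p).comp (Ideal.Quotient.mk I), ?_⟩
    simp only [Subtype.mk.injEq]
    ext x
    rw [RingHom.mem_ker]
    simp [Ideal.Quotient.eq_zero_iff_mem]

end IdealVM


namespace IdealVM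
open Ideal NumberField Filter Topology

variable (K : Type*) [Field K] [NumberField K]

theorem theta_of_count (κ C δ : ℝ) (hκ : 0 < κ) (hδ : 0 < δ)
    (h : ∀ x : ℝ, 1 ≤ x → |(∑ k ∈ Finset.Icc 1 ⌊x⌋₊, aK K k) - κ * x| ≤ C * x ^ (1 - δ)) :
    Tendsto (fun x : ℝ => (∑ p ∈ Finset.Ioc 0 ⌊x⌋₊ with p.Prime,
      (Nat.card (𝓞 K →+* ZMod p) : ℝ) * Real.log p) / x) atTop (𝓝 1) := by
  set d : ℝ := ((Module.finrank ℚ K : ℕ) : ℝ) with hd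
  have hIcc : ∀ n : ℕ, Finset.Icc 1 n = Finset.Ioc 0 n := fun n => rfl
  have hB : ∀ x : ℝ, 1 ≤ x → (∑ k ∈ Finset.Icc 1 ⌊x⌋₊, LK K k) ≤ (d * (Real.log 4 + 4)) * x := by
    intro x hx
    calc _ ≤ ∑ k ∈ Finset.Icc 1 ⌊x⌋₊, d * ArithmeticFunction.vonMangoldt k :=
          Finset.sum_le_sum fun k _ => LK_le K k
      _ = d * Chebyshev.psi x := by rw [← Finset.mul_sum, hIcc]; rfl
      _ ≤ d * ((Real.log 4 + 4) * x) := by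
          gcongr
          exact Chebyshev.psi_le_const_mul_self (by linarith)
      _ = _ := by ring
  have main := BeurlingPNT.pnt (aK K) (LK K) (aK_nonneg K) (LK_nonneg K) κ C δ _ hκ hδ h hB (conv K)
  obtain ⟨C', hC'⟩ := Chebyshev.psi_sub_theta_le_mul_sqrt
  have hsplit : ∀ x : ℝ, ∑ k ∈ Finset.Icc 1 ⌊x⌋₊, LK K k =
      (∑ p ∈ Finset.Ioc 0 ⌊x⌋₊ with p.Prime, (Nat.card (𝓞 K →+* ZMod p) : ℝ) * Real.log p) +
      ∑ p ∈ Finset.Ioc 0 ⌊x⌋₊ with ¬ p.Prime, LK K p := by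
    intro x
    rw [hIcc, ← Finset.sum_filter_add_sum_filter_not _ (fun p => Nat.Prime p)]
    congr 1
    refine Finset.sum_congr rfl fun p hp => ?_
    rw [LK_prime K p (Finset.mem_filter.1 hp).2, aK_prime K p (Finset.mem_filter.1 hp).2]
  have hsmall : Tendsto (fun x : ℝ => (∑ p ∈ Finset.Ioc 0 ⌊x⌋₊ with ¬ p.Prime, LK K p) / x) atTop (𝓝 0) := by
    have hz : Tendsto (fun x : ℝ => d * C' * (√x)⁻¹) atTop (𝓝 0) := by
      have := (tendsto_inv_atTop_zero.comp Real.tendsto_sqrt_atTop).const_mul (d * C')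
      simpa using this
    refine tendsto_of_tendsto_of_tendsto_of_le_of_le' tendsto_const_nhds hz ?_ ?_
    · filter_upwards [eventually_gt_atTop 0] with x hx
      exact div_nonneg (Finset.sum_nonneg fun k _ => LK_nonneg K k) hx.le
    · filter_upwards [eventually_gt_atTop 0] with x hx
      rw [div_le_iff₀ hx]
      calc _ ≤ ∑ k ∈ Finset.Ioc 0 ⌊x⌋₊ with ¬ k.Prime, d * ArithmeticFunction.vonMangoldt k :=
            Finset.sum_le_sum fun k _ => LK_le K k
        _ = d * (Chebyshev.psi x - Chebyshev.theta x) := by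
            rw [← Finset.mul_sum, Chebyshev.psi_sub_theta_eq_sum_not_prime]
        _ ≤ d * (C' * √x) := by
            gcongr
            exact hC' x
        _ = d * C' * (√x)⁻¹ * x := by
            have : √x ≠ 0 := (Real.sqrt_pos.2 hx).ne'
            have h2 : x = √x * √x := (Real.mul_self_sqrt hx.le).symm
            conv_rhs => rw [h2]
            field_simp
            rw [Real.sqrt_sq (Real.sqrt_nonneg x)]
  have := main.sub hsmall
  rw [sub_zero] at this
  refine this.congr fun x => ?_
  rw [hsplit x]
  ring

end IdealVM


namespace LatCount
open Finset Module NumberField NumberField.InfinitePlace NumberField.mixedEmbedding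
  NumberField.mixedEmbedding.fundamentalCone NumberField.Units NumberField.Units.dirichletUnitTheorem
open ENNReal MeasureTheory

variable (K : Type*) [Field K] [NumberField K]

open scoped Classical in
/-- parameter box -/
noncomputable def box (b c d : ℝ) : Set (realSpace K) :=
  Set.univ.pi fun w => if w = w₀ then Set.Iic b else Set.Ico c d

/-- region of the mixed space parametrised by a box -/
noncomputable def W (b c d : ℝ) : Set (mixedSpace K) :=
  normAtAllPlaces ⁻¹' (expMapBasis '' (box K b c d))

lemma measurableSet_box (b c d : ℝ) : MeasurableSet (box K b c d) := by
  refine MeasurableSet.univ_pi fun _ ↦ ?_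
  split_ifs
  · exact measurableSet_Iic
  · exact measurableSet_Ico

lemma measurableSet_W (b c d : ℝ) : MeasurableSet (W K b c d) := by
  refine (continuous_normAtAllPlaces K).measurable ?_
  exact (measurableSet_box K b c d).image_of_continuousOn_injOn
    (continuous_expMapBasis K).continuousOn (injective_expMapBasis K).injOn

lemma setLIntegral_box_exp {n : ℕ} (hn : 0 < n) (b c d : ℝ) :
    ∫⁻ (x : realSpace K) in box K b c d, .ofReal (Real.exp (x w₀ * n)) =
      ENNReal.ofReal (Real.exp (n * b) / n) * ENNReal.ofReal (d - c) ^ (Fintype.card (InfinitePlace K) - 1) := by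
  classical
  have hn : 0 < (n : ℝ) := Nat.cast_pos.mpr hn
  rw [volume_pi, box, Measure.restrict_pi_pi, lintegral_eq_lmarginal_univ 0,
    lmarginal_erase' _ (by fun_prop) (Finset.mem_univ w₀), if_pos rfl]
  simp_rw [Function.update_self, lmarginal, lintegral_const, Measure.pi_univ, if_neg
    (Finset.ne_of_mem_erase (Subtype.prop _)), Measure.restrict_apply_univ, Real.volume_Ico,
    mul_comm _ (n : ℝ)]
  rw [← ofReal_integral_eq_lintegral_ofReal (integrableOn_exp_mul_Iic hn _), integral_exp_mul_Iic
    hn]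
  · congr 1
    rw [Finset.prod_const]
    congr 1
    simp
  filter_upwards with _ using Real.exp_nonneg _

open scoped Classical in
lemma volume_W (b c d : ℝ) : volume (W K b c d) = volume (normLeOne K) *
    (ENNReal.ofReal (Real.exp (finrank ℚ K * b)) *
      ENNReal.ofReal (d - c) ^ (Fintype.card (InfinitePlace K) - 1)) := by
  have hv : volume (W K b c d) = 2 ^ nrRealPlaces K * NNReal.pi ^ nrComplexPlaces K * .ofReal (regulator K) *
      (finrank ℚ K * ∫⁻ (x : realSpace K) in box K b c d, .ofReal (Real.exp (x w₀ * finrank ℚ K))) := by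
    rw [W, volume_eq_two_pow_mul_two_pi_pow_mul_integral Set.preimage_image_preimage
      (measurableSet_W K b c d),
      normAtAllPlaces_image_preimage_expMapBasis,
      setLIntegral_expMapBasis_image (measurableSet_box K b c d) (by fun_prop)]
    simp_rw [ENNReal.inv_mul_cancel_right
      (Finset.prod_ne_zero_iff.mpr fun _ _ ↦ ofReal_ne_zero_iff.mpr (expMapBasis_pos _ _))
      (prod_ne_top fun _ _ ↦ ofReal_ne_top)]
    rw [ofReal_mul zero_le_two, mul_pow,
      ofReal_ofNat, coe_nnreal_eq, NNReal.coe_real_pi]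
    have h2 : (2:ℝ≥0∞) ^ nrComplexPlaces K * 2⁻¹ ^ nrComplexPlaces K = 1 := by
      rw [← mul_pow, ENNReal.mul_inv_cancel two_ne_zero ENNReal.ofNat_ne_top, one_pow]
    set X := ∫⁻ (x : realSpace K) in box K b c d, ENNReal.ofReal (Real.exp (x w₀ * finrank ℚ K))
    calc _ = 2 ^ nrRealPlaces K * ENNReal.ofReal Real.pi ^ nrComplexPlaces K * .ofReal (regulator K) *
        (finrank ℚ K * X) * ((2:ℝ≥0∞) ^ nrComplexPlaces K * 2⁻¹ ^ nrComplexPlaces K) := by ring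
      _ = _ := by rw [h2, mul_one]
  have hn : (0:ℝ) < finrank ℚ K := by exact_mod_cast finrank_pos
  rw [hv, volume_normLeOne, setLIntegral_box_exp K finrank_pos]
  congr 1
  rw [← mul_assoc]
  congr 1
  rw [← ENNReal.ofReal_natCast, ← ENNReal.ofReal_mul hn.le]
  congr 1
  field_simp

open scoped Classical in
lemma vol_pos : 0 < volume.real (normLeOne K) := by
  rw [Measure.real, ENNReal.toReal_pos_iff]
  constructor
  · rw [volume_normLeOne]
    have := regulator_pos K
    have h2 : (NNReal.pi : ℝ≥0∞) ≠ 0 := by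
      exact_mod_cast (NNReal.pi_pos).ne'
    refine pos_iff_ne_zero.2 (mul_ne_zero (mul_ne_zero (by simp) (pow_ne_zero _ h2)) (by simpa using this))
  · exact (isBounded_normLeOne K).measure_lt_top

open scoped Classical in
lemma volume_W_ne_top (b c d : ℝ) : volume (W K b c d) ≠ ⊤ := by
  rw [volume_W]
  refine mul_ne_top (isBounded_normLeOne K).measure_lt_top.ne (mul_ne_top ofReal_ne_top (pow_ne_top ofReal_ne_top))

open scoped Classical in
lemma vol_W (b c d : ℝ) (hcd : c ≤ d) : volume.real (W K b c d) = volume.real (normLeOne K) *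
    (Real.exp (finrank ℚ K * b) * (d - c) ^ (Fintype.card (InfinitePlace K) - 1)) := by
  rw [Measure.real, volume_W, ENNReal.toReal_mul, ENNReal.toReal_mul, ENNReal.toReal_pow,
    toReal_ofReal (Real.exp_pos _).le, toReal_ofReal (by linarith)]
  rfl

end LatCount


namespace LatCount
open Finset Module NumberField NumberField.InfinitePlace NumberField.mixedEmbedding
  NumberField.mixedEmbedding.fundamentalCone NumberField.Units NumberField.Units.dirichletUnitTheorem
open ENNReal MeasureTheory

variable (K : Type*) [Field K] [NumberField K]

lemma mem_box {b c d : ℝ} {u : realSpace K} : u ∈ box K b c d ↔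
    u w₀ ≤ b ∧ ∀ w, w ≠ w₀ → c ≤ u w ∧ u w < d := by
  classical
  rw [box, Set.mem_univ_pi]
  constructor
  · intro h
    refine ⟨by simpa using h w₀, fun w hw => by simpa [hw] using h w⟩
  · rintro ⟨h1, h2⟩ w
    by_cases hw : w = w₀
    · subst hw; simpa using h1
    · simpa [hw] using h2 w hw

lemma mem_W {b c d : ℝ} {x : mixedSpace K} : x ∈ W K b c d ↔
    ∃ u, u ∈ box K b c d ∧ expMapBasis u = normAtAllPlaces x := Iff.rfl

open scoped Classical in
lemma expMapBasis_shift (u : realSpace K) (b : ℝ) :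
    expMapBasis (Function.update u w₀ (u w₀ + b)) = Real.exp b • expMapBasis u := by
  rw [expMapBasis_apply'', expMapBasis_apply'' u, smul_smul, ← Real.exp_add]
  congr 1
  · simp [add_comm]
  · congr 1
    ext i
    by_cases hi : i = w₀ <;> simp [hi]

lemma cone_eq_W (b : ℝ) (x : mixedSpace K) :
    (x ∈ fundamentalCone K ∧ mixedEmbedding.norm x ≤ Real.exp (finrank ℚ K * b)) ↔ x ∈ W K b 0 1 := by
  classical
  have hy : ∀ w, normAtAllPlaces (Real.exp (-b) • x) w = Real.exp (-b) * normAtAllPlaces x w := by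
    intro w
    rw [normAtAllPlaces_apply, normAtPlace_smul, abs_of_pos (Real.exp_pos _)]
  have h1 : (x ∈ fundamentalCone K ∧ mixedEmbedding.norm x ≤ Real.exp (finrank ℚ K * b)) ↔
      Real.exp (-b) • x ∈ normLeOne K := by
    rw [mem_normLeOne, smul_mem_iff_mem (Real.exp_pos _).ne', mixedEmbedding.norm_smul,
      abs_of_pos (Real.exp_pos _), ← Real.exp_nat_mul]
    refine and_congr_right fun _ => ?_
    rw [mul_neg, Real.exp_neg, inv_mul_le_iff₀ (Real.exp_pos _), mul_one]
  have h2 : paramSet K = box K 0 0 1 := rfl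
  rw [h1, normLeOne_eq_preimage, h2, mem_W]
  constructor
  · rintro ⟨u, hu, hux⟩
    refine ⟨Function.update u w₀ (u w₀ + b), ?_, ?_⟩
    · rw [mem_box] at hu ⊢
      refine ⟨by simpa using hu.1, fun w hw => by simpa [hw] using hu.2 w hw⟩
    · rw [expMapBasis_shift, hux]
      ext w
      rw [Pi.smul_apply, hy, smul_eq_mul, ← mul_assoc, ← Real.exp_add]; simp
  · rintro ⟨u, hu, hux⟩
    refine ⟨Function.update u w₀ (u w₀ + -b), ?_, ?_⟩
    · rw [mem_box] at hu ⊢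
      refine ⟨by simpa using hu.1, fun w hw => by simpa [hw] using hu.2 w hw⟩
    · rw [expMapBasis_shift, hux]
      ext w
      rw [Pi.smul_apply, hy, smul_eq_mul]

lemma bounds : ∃ c > 0, ∃ D > 0, ∀ u : realSpace K, (∀ w, w ≠ w₀ → -1 ≤ u w ∧ u w ≤ 2) →
    ∀ w, c * Real.exp (u w₀) ≤ expMapBasis u w ∧ expMapBasis u w ≤ D * Real.exp (u w₀) := by
  classical
  let S : Set (realSpace K) := Set.Icc (fun _ => -1) (fun _ => 2)
  have hS : IsCompact S := isCompact_Icc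
  have hne : (0 : realSpace K) ∈ S := ⟨fun _ => by simp, fun _ => by simp⟩
  have key : ∀ w : InfinitePlace K, ∃ c > 0, ∃ D > 0, ∀ u ∈ S, c ≤ expMapBasis u w ∧ expMapBasis u w ≤ D := by
    intro w
    have hc : Continuous fun u : realSpace K => expMapBasis u w :=
      (continuous_apply w).comp (continuous_expMapBasis K)
    obtain ⟨a, ha, ha'⟩ := hS.exists_isMinOn ⟨0, hne⟩ hc.continuousOn
    obtain ⟨d, hd, hd'⟩ := hS.exists_isMaxOn ⟨0, hne⟩ hc.continuousOn
    exact ⟨_, expMapBasis_pos a w, _, expMapBasis_pos d w, fun u hu => ⟨ha' hu, hd' hu⟩⟩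
  choose c hc D hD h using key
  refine ⟨univ.inf' univ_nonempty c, ?_, univ.sup' univ_nonempty D, ?_, ?_⟩
  · simpa [Finset.lt_inf'_iff] using hc
  · obtain ⟨w⟩ : Nonempty (InfinitePlace K) := inferInstance
    exact (hD w).trans_le (Finset.le_sup' D (mem_univ w))
  · intro u hu w
    rw [expMapBasis_apply'', Pi.smul_apply, smul_eq_mul]
    have hm : (fun i ↦ if i = w₀ then 0 else u i) ∈ S := by
      constructor <;> intro i <;> by_cases hi : i = w₀ <;> simp [hi, hu]
    have := h w _ hm
    constructor
    · rw [mul_comm]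
      gcongr
      exact (Finset.inf'_le c (mem_univ w)).trans this.1
    · rw [mul_comm _ (Real.exp (u w₀))]
      gcongr
      exact this.2.trans (Finset.le_sup' D (mem_univ w))

lemma log_pert {a b R M : ℝ} (hM : 0 < M) (hR : 2 * M ≤ R) (ha : R ≤ a) (hab : |b - a| ≤ M) :
    0 < b ∧ |Real.log b - Real.log a| ≤ 2 * M / R := by
  have hRp : 0 < R := by linarith
  have h := abs_le.1 hab
  have hb : R / 2 ≤ b := by linarith
  have hbp : 0 < b := by linarith
  have hap : 0 < a := by linarith
  refine ⟨hbp, ?_⟩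
  have h1 := Real.log_le_sub_one_of_pos (div_pos hbp hap)
  have h2 := Real.log_le_sub_one_of_pos (div_pos hap hbp)
  rw [Real.log_div hbp.ne' hap.ne'] at h1
  rw [Real.log_div hap.ne' hbp.ne'] at h2
  have h3 : b / a - 1 ≤ 2 * M / R := by
    rw [div_sub_one hap.ne', div_le_div_iff₀ hap hRp]
    nlinarith
  have h4 : a / b - 1 ≤ 2 * M / R := by
    rw [div_sub_one hbp.ne', div_le_div_iff₀ hbp hRp]
    nlinarith
  rw [abs_le]; constructor <;> linarith

lemma pert : ∃ A > 0, ∀ M > 0, ∀ R, 2 * M ≤ R → ∀ u v : realSpace K, (∀ w, R ≤ expMapBasis u w) →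
    (∀ w, |v w - expMapBasis u w| ≤ M) → ∃ u', expMapBasis u' = v ∧ ∀ w, |u' w - u w| ≤ A * M / R := by
  classical
  let L := (completeBasis K).equivFunL
  refine ⟨(‖(L : realSpace K →L[ℝ] realSpace K)‖ + 1) * 4, by positivity, ?_⟩
  intro M hM R hR u v hu hv
  have hRp : 0 < R := by linarith
  have hl := fun w => log_pert hM hR (hu w) (hv w)
  refine ⟨expMapBasis.symm v, expMapBasis.right_inv (Set.mem_univ_pi.mpr fun w => (hl w).1), ?_⟩
  have e1 : expMapBasis.symm v = L (expMap.symm v) := rfl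
  have e2 : u = L (expMap.symm (expMapBasis u)) := by
    have : expMapBasis.symm (expMapBasis u) = u := expMapBasis.left_inv (by rw [expMapBasis_source]; trivial)
    exact this.symm
  have e3 : expMapBasis.symm v - u = L (expMap.symm v - expMap.symm (expMapBasis u)) := by
    rw [map_sub, ← e2, e1]
  have e4 : ‖expMap.symm v - expMap.symm (expMapBasis u)‖ ≤ 4 * M / R := by
    rw [pi_norm_le_iff_of_nonneg (by positivity)]
    intro w
    rw [Pi.sub_apply, expMap_symm_apply, expMap_symm_apply, ← mul_sub, norm_mul, Real.norm_eq_abs,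
      Real.norm_eq_abs, Nat.abs_cast]
    have hm : (w.mult : ℝ) ≤ 2 := by
      rw [InfinitePlace.mult]; split_ifs <;> norm_num
    calc (w.mult : ℝ) * |Real.log (v w) - Real.log (expMapBasis u w)| ≤ 2 * (2 * M / R) := by
          gcongr; exact (hl w).2
      _ = _ := by ring
  intro w
  calc |expMapBasis.symm v w - u w| = ‖(expMapBasis.symm v - u) w‖ := rfl
    _ ≤ ‖expMapBasis.symm v - u‖ := norm_le_pi_norm _ w
    _ = ‖(L : realSpace K →L[ℝ] realSpace K) (expMap.symm v - expMap.symm (expMapBasis u))‖ := by rw [e3]; rfl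
    _ ≤ ‖(L : realSpace K →L[ℝ] realSpace K)‖ * ‖expMap.symm v - expMap.symm (expMapBasis u)‖ :=
      ContinuousLinearMap.le_opNorm _ _
    _ ≤ (‖(L : realSpace K →L[ℝ] realSpace K)‖ + 1) * (4 * M / R) := by gcongr; linarith
    _ = _ := by ring

open scoped Classical in
lemma normAtPlace_le_norm (x : mixedSpace K) (w : InfinitePlace K) : normAtPlace w x ≤ ‖x‖ := by
  rw [norm_eq_sup'_normAtPlace]
  exact Finset.le_sup' (fun w => normAtPlace w x) (mem_univ w)

open scoped Classical in
lemma norm_le_of (x : mixedSpace K) (B : ℝ) (h : ∀ w, normAtPlace w x ≤ B) : ‖x‖ ≤ B := by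
  rw [norm_eq_sup'_normAtPlace]
  exact Finset.sup'_le _ _ fun w _ => h w

open scoped Classical in
lemma normAt_lip (x y : mixedSpace K) (w : InfinitePlace K) :
    |normAtAllPlaces x w - normAtAllPlaces y w| ≤ ‖x - y‖ := by
  have h1 := normAtPlace_add_le w (x - y) y
  have h2 := normAtPlace_add_le w (y - x) x
  rw [sub_add_cancel] at h1 h2
  have h3 := normAtPlace_le_norm K (x - y) w
  have h4 := normAtPlace_le_norm K (y - x) w
  rw [norm_sub_rev] at h4
  rw [abs_le, normAtAllPlaces_apply, normAtAllPlaces_apply]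
  constructor <;> linarith

open scoped Classical in
/-- the key sandwich -/
lemma sandwich (M : ℝ) (hM : 0 < M) : ∃ B > 0, ∃ E > 0, ∀ b : ℝ, 0 ≤ b → B ≤ Real.exp (b / 2) →
    E * Real.exp (-(b / 2)) ≤ 1 / 4 ∧
    ∀ x y : mixedSpace K, ‖x - y‖ ≤ M →
    (x ∈ W K b 0 1 → y ∈ W K (b + E * Real.exp (-(b / 2))) (-(E * Real.exp (-(b / 2)))) (1 + E * Real.exp (-(b / 2)))
        ∪ Metric.closedBall 0 (E * Real.exp (b / 2))) ∧
    (y ∈ W K (b - E * Real.exp (-(b / 2))) (E * Real.exp (-(b / 2))) (1 - E * Real.exp (-(b / 2))) \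
        W K (b / 2) (E * Real.exp (-(b / 2))) (1 - E * Real.exp (-(b / 2))) → x ∈ W K b 0 1) := by
  obtain ⟨c, hc, D, hD, hb⟩ := bounds K
  obtain ⟨A, hA, hp⟩ := pert K
  let E := A * M / c + D + M
  have hE : 0 < E := by positivity
  refine ⟨max (2 * M / c) (4 * E), lt_max_of_lt_right (by positivity), E, hE, ?_⟩
  intro b hb0 hB
  set r := Real.exp (b / 2) with hr
  have hrp : 0 < r := Real.exp_pos _
  have hr1 : 1 ≤ r := Real.one_le_exp (by linarith)
  have hri : Real.exp (-(b / 2)) = r⁻¹ := Real.exp_neg _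
  rw [hri]
  have hB1 : 2 * M ≤ c * r := by
    have := (le_max_left _ _).trans hB
    rw [div_le_iff₀ hc] at this; linarith
  have hB2 : 4 * E ≤ r := (le_max_right _ _).trans hB
  have hε : E * r⁻¹ ≤ 1 / 4 := by
    rw [← div_eq_mul_inv, div_le_iff₀ hrp]; linarith
  have hε0 : 0 < E * r⁻¹ := by positivity
  have hAE : A * M / (c * r) ≤ E * r⁻¹ := by
    rw [← div_div, div_eq_mul_inv _ r]
    gcongr
    show A * M / c ≤ A * M / c + D + M
    linarith
  set ε := E * r⁻¹
  refine ⟨hε, fun x y hxy => ⟨?_, ?_⟩⟩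
  · rw [mem_W]
    rintro ⟨u, hu, hux⟩
    rw [mem_box] at hu
    by_cases hub : b / 2 ≤ u w₀
    · left
      have hR : ∀ w, c * r ≤ expMapBasis u w := fun w => le_trans (by
        have := Real.exp_le_exp.2 hub; gcongr) (hb u (fun w hw => by
          have := hu.2 w hw; constructor <;> linarith) w).1
      obtain ⟨u', h1, h2⟩ := hp M hM _ hB1 u (normAtAllPlaces y) hR (fun w => by
        rw [hux]; exact (normAt_lip K y x w).trans (by rwa [norm_sub_rev]))
      refine ⟨u', ?_, h1⟩
      rw [mem_box]
      have h3 := fun w => abs_le.1 ((h2 w).trans hAE)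
      refine ⟨by linarith [(h3 w₀).2], fun w hw => ?_⟩
      have := hu.2 w hw
      constructor <;> linarith [(h3 w).1, (h3 w).2]
    · right
      rw [mem_closedBall_zero_iff]
      have hxn : ‖x‖ ≤ D * r := by
        apply norm_le_of
        intro w
        rw [← normAtAllPlaces_apply, ← hux]
        refine (hb u (fun w hw => by have := hu.2 w hw; constructor <;> linarith) w).2.trans ?_
        have := Real.exp_le_exp.2 (not_le.1 hub).le
        gcongr
      calc ‖y‖ = ‖x - (x - y)‖ := by congr 1; abel
        _ ≤ ‖x‖ + ‖x - y‖ := norm_sub_le _ _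
        _ ≤ D * r + M * r := by nlinarith
        _ ≤ E * r := by
          have : 0 ≤ A * M / c := by positivity
          show _ ≤ (A * M / c + D + M) * r
          nlinarith
  · rintro ⟨⟨u, hu, huy⟩, h0⟩
    rw [mem_W] at h0 ⊢
    have hub : b / 2 < u w₀ := by
      by_contra hcon
      rw [mem_box] at hu
      exact h0 ⟨u, (mem_box K).2 ⟨not_lt.1 hcon, hu.2⟩, huy⟩
    rw [mem_box] at hu
    have hR : ∀ w, c * r ≤ expMapBasis u w := fun w => le_trans (by
      have := Real.exp_le_exp.2 hub.le; gcongr) (hb u (fun w hw => by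
        have := hu.2 w hw; constructor <;> linarith) w).1
    obtain ⟨u', h1, h2⟩ := hp M hM _ hB1 u (normAtAllPlaces x) hR (fun w => by
      rw [huy]; exact (normAt_lip K x y w).trans hxy)
    refine ⟨u', ?_, h1⟩
    rw [mem_box]
    have h3 := fun w => abs_le.1 ((h2 w).trans hAE)
    refine ⟨by linarith [(h3 w₀).2], fun w hw => ?_⟩
    have := hu.2 w hw
    constructor <;> linarith [(h3 w).1, (h3 w).2]

open scoped Classical in
lemma isBounded_W (b : ℝ) : Bornology.IsBounded (W K b 0 1) := by
  obtain ⟨c, hc, D, hD, hb⟩ := bounds K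
  rw [isBounded_iff_forall_norm_le]
  refine ⟨D * Real.exp b, ?_⟩
  rintro x ⟨u, hu, hux⟩
  rw [mem_box] at hu
  apply norm_le_of
  intro w
  rw [← normAtAllPlaces_apply, ← hux]
  refine (hb u (fun w hw => by have := hu.2 w hw; constructor <;> linarith) w).2.trans ?_
  have := Real.exp_le_exp.2 hu.1
  gcongr

end LatCount


namespace LatCount
open Finset Module NumberField NumberField.InfinitePlace NumberField.mixedEmbedding
  NumberField.mixedEmbedding.fundamentalCone NumberField.Units NumberField.Units.dirichletUnitTheorem
open ENNReal MeasureTheory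

section general
variable {E ι : Type*} [NormedAddCommGroup E] [NormedSpace ℝ E] [MeasurableSpace E] [BorelSpace E]
  [FiniteDimensional ℝ E] [Fintype ι] (μ : Measure E) [μ.IsAddHaarMeasure] (b : Basis ι ℝ E)

lemma tiles (A : Finset E) (hA : ∀ x ∈ A, x ∈ Submodule.span ℤ (Set.range b)) :
    μ (⋃ x ∈ A, (fun y => y + -x) ⁻¹' (ZSpan.fundamentalDomain b)) = A.card * μ (ZSpan.fundamentalDomain b) := by
  rw [measure_biUnion_finset]
  · simp [measure_preimage_add_right]
  · intro x hx x' hx' hne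
    rw [Function.onFun, Set.disjoint_left]
    intro y hy hy'
    obtain ⟨v, -, hv⟩ := ZSpan.exist_unique_vadd_mem_fundamentalDomain b y
    have h1 := hv ⟨-x, Submodule.neg_mem _ (hA x hx)⟩ (by
      show _ +ᵥ y ∈ _
      rw [Submodule.vadd_def, vadd_eq_add, add_comm]; exact hy)
    have h2 := hv ⟨-x', Submodule.neg_mem _ (hA x' hx')⟩ (by
      show _ +ᵥ y ∈ _
      rw [Submodule.vadd_def, vadd_eq_add, add_comm]; exact hy')
    have := congrArg Subtype.val (h1.trans h2.symm)
    exact hne (neg_injective this)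
  · intro x _
    exact (measurable_add_const _) (ZSpan.fundamentalDomain_measurableSet b)

lemma count_bounds (S U T : Set E) (hS : Bornology.IsBounded S) (hU : μ U ≠ ⊤)
    (h1 : ∀ x ∈ S, ∀ y, y - x ∈ ZSpan.fundamentalDomain b → y ∈ U)
    (h2 : ∀ y ∈ T, ∀ x, y - x ∈ ZSpan.fundamentalDomain b → x ∈ S) :
    ((S ∩ Submodule.span ℤ (Set.range b)).ncard : ℝ) * μ.real (ZSpan.fundamentalDomain b) ≤ μ.real U ∧
    μ.real T ≤ ((S ∩ Submodule.span ℤ (Set.range b)).ncard : ℝ) * μ.real (ZSpan.fundamentalDomain b) := by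
  have : ProperSpace E := FiniteDimensional.proper ℝ E
  have hfin := ZSpan.setFinite_inter b hS
  have ht := tiles μ b hfin.toFinset (fun x hx => by
    rw [Set.Finite.mem_toFinset] at hx; exact hx.2)
  have hF : μ (ZSpan.fundamentalDomain b) ≠ ⊤ := (ZSpan.fundamentalDomain_isBounded b).measure_lt_top.ne
  have hr : μ.real (⋃ x ∈ hfin.toFinset, (fun y => y + -x) ⁻¹' (ZSpan.fundamentalDomain b)) =
      ((S ∩ Submodule.span ℤ (Set.range b)).ncard : ℝ) * μ.real (ZSpan.fundamentalDomain b) := by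
    rw [Measure.real, ht, ENNReal.toReal_mul, Measure.real, Set.ncard_eq_toFinset_card _ hfin]
    simp
  rw [← hr]
  constructor
  · refine measureReal_mono ?_ hU
    intro y hy
    simp only [Set.mem_iUnion] at hy
    obtain ⟨x, hx, hy⟩ := hy
    rw [Set.Finite.mem_toFinset] at hx
    exact h1 x hx.1 y (by rw [sub_eq_add_neg]; exact hy)
  · refine measureReal_mono ?_ (by rw [ht]; exact mul_ne_top (by simp) hF)
    intro y hy
    simp only [Set.mem_iUnion]
    refine ⟨y - ZSpan.fract b y, ?_, ?_⟩
    · rw [Set.Finite.mem_toFinset]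
      refine ⟨h2 y hy _ ?_, ?_⟩
      · rw [_root_.sub_sub_cancel]; exact ZSpan.fract_mem_fundamentalDomain b y
      · rw [ZSpan.fract_apply, _root_.sub_sub_cancel]
        exact (ZSpan.floor b y).2
    · rw [Set.mem_preimage]
      rw [← sub_eq_add_neg, _root_.sub_sub_cancel]; exact ZSpan.fract_mem_fundamentalDomain b y

end general

lemma exp_upper {n k : ℕ} {ε : ℝ} (h0 : 0 ≤ ε) (h1 : ε ≤ 1 / 4) :
    Real.exp (n * ε) * (1 + 2 * ε) ^ k ≤ 1 + (n + 2 * k) * Real.exp (n + 2 * k) * ε := by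
  have h2 : (1 + 2 * ε) ^ k ≤ Real.exp (2 * k * ε) := by
    have : 1 + 2 * ε ≤ Real.exp (2 * ε) := by linarith [Real.add_one_le_exp (2 * ε)]
    calc (1 + 2 * ε) ^ k ≤ Real.exp (2 * ε) ^ k := by gcongr
      _ = _ := by rw [← Real.exp_nat_mul]; ring_nf
  set a : ℝ := n + 2 * k with ha
  have ha0 : 0 ≤ a := by positivity
  have h3 : Real.exp (n * ε) * (1 + 2 * ε) ^ k ≤ Real.exp (a * ε) := by
    calc _ ≤ Real.exp (n * ε) * Real.exp (2 * k * ε) := by gcongr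
      _ = _ := by rw [← Real.exp_add, ha]; ring_nf
  refine h3.trans ?_
  have h4 := Real.add_one_le_exp (-(a * ε))
  have h5 : Real.exp (a * ε) * Real.exp (-(a * ε)) = 1 := by rw [← Real.exp_add]; simp
  have h6 : Real.exp (a * ε) ≤ Real.exp a := Real.exp_le_exp.2 (by nlinarith)
  have h7 := Real.exp_pos (a * ε)
  have h8 : 0 ≤ a * ε := by positivity
  nlinarith

lemma exp_lower {n k : ℕ} {ε : ℝ} (h0 : 0 ≤ ε) (h1 : ε ≤ 1 / 4) :
    1 - (n + 4 * k) * ε ≤ Real.exp (-(n * ε)) * (1 - 2 * ε) ^ k := by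
  have h2 : Real.exp (-(4 * ε)) ≤ 1 - 2 * ε := by
    rw [Real.exp_neg, inv_le_comm₀ (Real.exp_pos _) (by linarith)]
    have h3 : 1 + 4 * ε ≤ Real.exp (4 * ε) := by linarith [Real.add_one_le_exp (4 * ε)]
    refine le_trans ?_ h3
    rw [inv_le_iff_one_le_mul₀ (by linarith)]
    nlinarith
  have h3 : Real.exp (-(4 * k * ε)) ≤ (1 - 2 * ε) ^ k := by
    calc _ = Real.exp (-(4 * ε)) ^ k := by rw [← Real.exp_nat_mul]; ring_nf
      _ ≤ _ := by gcongr
  calc 1 - (n + 4 * k) * ε ≤ Real.exp (-((n + 4 * k) * ε)) := by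
        linarith [Real.add_one_le_exp (-(((n : ℝ) + 4 * k) * ε))]
    _ = Real.exp (-(n * ε)) * Real.exp (-(4 * k * ε)) := by rw [← Real.exp_add]; ring_nf
    _ ≤ _ := by gcongr

variable (K : Type*) [Field K] [NumberField K]

open scoped Classical in
set_option maxHeartbeats 1000000 in
lemma lattice_count {ι : Type*} [Fintype ι] (β : Basis ι ℝ (mixedSpace K)) :
    ∃ C, ∀ b : ℝ, 0 ≤ b →
    |((W K b 0 1 ∩ Submodule.span ℤ (Set.range β)).ncard : ℝ) * volume.real (ZSpan.fundamentalDomain β)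
      - volume.real (normLeOne K) * Real.exp (finrank ℚ K * b)| ≤
      C * Real.exp (finrank ℚ K * b - b / 2) := by
  set V := volume.real (ZSpan.fundamentalDomain β) with hV
  set v := volume.real (normLeOne K) with hv
  set n := finrank ℚ K with hn
  set k := Fintype.card (InfinitePlace K) - 1 with hk
  have hv0 : 0 ≤ v := measureReal_nonneg
  have hV0 : 0 ≤ V := measureReal_nonneg
  have hn1 : (1:ℝ) ≤ n := by exact_mod_cast (finrank_pos : 0 < finrank ℚ K)
  set N : ℝ → ℝ := fun b => ((W K b 0 1 ∩ Submodule.span ℤ (Set.range β)).ncard : ℝ) with hN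
  obtain ⟨M, hM⟩ := (ZSpan.fundamentalDomain_isBounded β).exists_pos_norm_le
  obtain ⟨hM0, hM⟩ := hM
  obtain ⟨B, hB, E, hE, hs⟩ := sandwich K M hM0
  have hmono : ∀ b b', b ≤ b' → N b ≤ N b' := by
    intro b b' hbb
    have : W K b 0 1 ⊆ W K b' 0 1 := by
      rintro x ⟨u, hu, h⟩
      rw [mem_box] at hu
      exact ⟨u, (mem_box K).2 ⟨hu.1.trans hbb, hu.2⟩, h⟩
    have h2 := Set.ncard_le_ncard (Set.inter_subset_inter_left
      (Submodule.span ℤ (Set.range β) : Set (mixedSpace K)) this)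
      (ZSpan.setFinite_inter β (isBounded_W K b'))
    exact Nat.cast_le.2 h2
  set v1 := volume.real (Metric.ball (0 : mixedSpace K) 1) with hv1
  have hv10 : 0 ≤ v1 := measureReal_nonneg
  set b0 := 2 * Real.log B with hb0
  set C1 := v * ((n + 2 * k) * Real.exp (n + 2 * k)) * E + v1 * E ^ n with hC1
  set C2 := v * (n + 4 * k) * E + v with hC2
  set C3 := N b0 * V + v * Real.exp (n * b0) with hC3
  have hC10 : 0 ≤ C1 := by positivity
  have hC20 : 0 ≤ C2 := by positivity
  have hC30 : 0 ≤ C3 := by positivity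
  refine ⟨C1 + C2 + C3, fun b hb => ?_⟩
  have hexp1 : 1 ≤ Real.exp (n * b - b / 2) := Real.one_le_exp (by nlinarith)
  by_cases hbB : B ≤ Real.exp (b / 2)
  · obtain ⟨hε, hs⟩ := hs b hb hbB
    set ε := E * Real.exp (-(b / 2)) with hεd
    have hε0 : 0 ≤ ε := by positivity
    set r := Real.exp (b / 2) with hr
    have hU : volume (W K (b + ε) (-ε) (1 + ε) ∪ Metric.closedBall 0 (E * r)) ≠ ⊤ :=
      (measure_union_lt_top (volume_W_ne_top K _ _ _).lt_top measure_closedBall_lt_top).ne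
    obtain ⟨hup, hlo⟩ := count_bounds volume β (W K b 0 1)
      (W K (b + ε) (-ε) (1 + ε) ∪ Metric.closedBall 0 (E * r))
      (W K (b - ε) ε (1 - ε) \ W K (b / 2) ε (1 - ε)) (isBounded_W K b) hU
      (fun x hx y hxy => (hs x y (by rw [norm_sub_rev]; exact hM _ hxy)).1 hx)
      (fun y hy x hxy => (hs x y (by rw [norm_sub_rev]; exact hM _ hxy)).2 hy)
    have hW1 : volume.real (W K (b + ε) (-ε) (1 + ε)) = v * (Real.exp (n * b) * (Real.exp (n * ε) * (1 + 2 * ε) ^ k)) := by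
      rw [vol_W K _ _ _ (by linarith), mul_add, Real.exp_add, ← hv, ← hn, ← hk]; ring_nf
    have hW2 : volume.real (W K (b - ε) ε (1 - ε)) = v * (Real.exp (n * b) * (Real.exp (-(n * ε)) * (1 - 2 * ε) ^ k)) := by
      rw [vol_W K _ _ _ (by linarith), mul_sub, sub_eq_add_neg, Real.exp_add, ← hv, ← hn, ← hk]; ring_nf
    have hW3 : volume.real (W K (b / 2) ε (1 - ε)) ≤ v * Real.exp (n * b - b / 2) := by
      rw [vol_W K _ _ _ (by linarith), ← hv, ← hn, ← hk]
      have : (1 - ε - ε) ^ k ≤ 1 := pow_le_one₀ (by linarith) (by linarith)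
      have h2 : Real.exp (n * (b / 2)) ≤ Real.exp (n * b - b / 2) := Real.exp_le_exp.2 (by nlinarith)
      have h3 : 0 ≤ (1 - ε - ε) ^ k := pow_nonneg (by linarith) _
      calc _ ≤ v * (Real.exp (n * b - b / 2) * 1) := by gcongr
        _ = _ := by ring
    have hball : volume.real (Metric.closedBall (0 : mixedSpace K) (E * r)) ≤ v1 * E ^ n * Real.exp (n * b - b / 2) := by
      rw [Measure.addHaar_real_closedBall _ _ (by positivity), mixedEmbedding.finrank, ← hn, mul_pow]
      have h2 : r ^ n ≤ Real.exp (n * b - b / 2) := by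
        rw [hr, ← Real.exp_nat_mul]; exact Real.exp_le_exp.2 (by nlinarith)
      calc _ = v1 * E ^ n * r ^ n := by ring
        _ ≤ _ := by gcongr
    have hTb : Real.exp (n * b) * ε = E * Real.exp (n * b - b / 2) := by
      rw [hεd, sub_eq_add_neg, Real.exp_add]; ring
    have up := measureReal_union_le (μ := volume) (W K (b + ε) (-ε) (1 + ε)) (Metric.closedBall 0 (E * r))
    have lo := le_measureReal_sdiff (μ := volume) (s₁ := W K (b - ε) ε (1 - ε)) (s₂ := W K (b / 2) ε (1 - ε))
      (volume_W_ne_top K _ _ _)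
    have u1 := exp_upper (n := n) (k := k) hε0 hε
    have l1 := exp_lower (n := n) (k := k) hε0 hε
    have u2 : v * (Real.exp (n * b) * (Real.exp (n * ε) * (1 + 2 * ε) ^ k)) ≤
        v * Real.exp (n * b) + v * ((n + 2 * k) * Real.exp (n + 2 * k)) * E * Real.exp (n * b - b / 2) := by
      calc _ ≤ v * (Real.exp (n * b) * (1 + (n + 2 * k) * Real.exp (n + 2 * k) * ε)) := by gcongr
        _ = v * Real.exp (n * b) + v * ((n + 2 * k) * Real.exp (n + 2 * k)) * (Real.exp (n * b) * ε) := by ring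
        _ = _ := by rw [hTb]; ring
    have l2 : v * Real.exp (n * b) - v * (n + 4 * k) * E * Real.exp (n * b - b / 2) ≤
        v * (Real.exp (n * b) * (Real.exp (-(n * ε)) * (1 - 2 * ε) ^ k)) := by
      calc _ = v * Real.exp (n * b) - v * (n + 4 * k) * (Real.exp (n * b) * ε) := by rw [hTb]; ring
        _ = v * (Real.exp (n * b) * (1 - (n + 4 * k) * ε)) := by ring
        _ ≤ _ := by gcongr
    set X := Real.exp (n * b - b / 2)
    have hX : 0 < X := Real.exp_pos _
    have e1 : C1 * X = v * ((n + 2 * k) * Real.exp (n + 2 * k)) * E * X + v1 * E ^ n * X := by rw [hC1]; ring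
    have e2 : C2 * X = v * (n + 4 * k) * E * X + v * X := by rw [hC2]; ring
    have p1 : 0 ≤ C1 * X := by positivity
    have p2 : 0 ≤ C2 * X := by positivity
    have p3 : 0 ≤ C3 * X := by positivity
    have e4 : (C1 + C2 + C3) * X = C1 * X + C2 * X + C3 * X := by ring
    rw [hW1] at up
    rw [hW2] at lo
    rw [abs_le, e4]
    clear_value C1 C2 C3 X
    constructor <;> linarith
  · have hbb : b ≤ b0 := by
      have : b / 2 ≤ Real.log B := by
        rw [Real.le_log_iff_exp_le hB]; exact (not_le.1 hbB).le
      rw [hb0]; linarith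
    have h1 := hmono b b0 hbb
    have h2 : Real.exp (n * b) ≤ Real.exp (n * b0) := Real.exp_le_exp.2 (by gcongr)
    have h3 : 0 ≤ N b := by positivity
    have h4 : N b * V ≤ N b0 * V := by gcongr
    have h5 : v * Real.exp (n * b) ≤ v * Real.exp (n * b0) := by gcongr
    have h6 : 0 ≤ v * Real.exp (n * b) := by positivity
    have h7 : 0 ≤ N b * V := by positivity
    calc |N b * V - v * Real.exp (n * b)| ≤ C3 := by rw [abs_le, hC3]; constructor <;> linarith
      _ ≤ (C1 + C2 + C3) * 1 := by linarith
      _ ≤ _ := by gcongr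

end LatCount


namespace LatCount
open Module NumberField NumberField.InfinitePlace NumberField.mixedEmbedding
  NumberField.mixedEmbedding.fundamentalCone NumberField.Units
open MeasureTheory
open scoped nonZeroDivisors Real
open Submodule Ideal

variable (K : Type*) [Field K] [NumberField K]

variable {C : ClassGroup (𝓞 K)} {J : (Ideal (𝓞 K))⁰} {s : ℝ}

theorem aux1 (hJ : ClassGroup.mk0 J = C⁻¹) :
    Nat.card {I : (Ideal (𝓞 K))⁰ // absNorm (I : Ideal (𝓞 K)) ≤ s ∧ ClassGroup.mk0 I = C}
      = Nat.card {I : (Ideal (𝓞 K))⁰ // (J : Ideal (𝓞 K)) ∣ I ∧ IsPrincipal (I : Ideal (𝓞 K)) ∧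
        absNorm (I : Ideal (𝓞 K)) ≤ s * absNorm (J : Ideal (𝓞 K))} := by
  simp_rw [← nonZeroDivisors_dvd_iff_dvd_coe]
  refine Nat.card_congr ?_
  refine ((Equiv.dvd J).subtypeEquiv fun I ↦ ?_).trans
    (Equiv.subtypeSubtypeEquivSubtypeInter (fun I : (Ideal (𝓞 K))⁰ ↦ J ∣ I) _)
  rw [← ClassGroup.mk0_eq_one_iff (SetLike.coe_mem _)]
  simp_rw [Equiv.dvd_apply, Submonoid.coe_mul, ← Submonoid.mul_def, _root_.map_mul, hJ,
    inv_mul_eq_one, Nat.cast_mul, mul_comm s, eq_comm, and_comm, and_congr_left_iff]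
  exact fun _ ↦
    (mul_le_mul_iff_of_pos_left (Nat.cast_pos.mpr (absNorm_pos_of_nonZeroDivisors J))).symm

lemma card_idealSet (b : ℝ) :
    Nat.card {a : idealSet K J // mixedEmbedding.norm (a : mixedSpace K) ≤ Real.exp (finrank ℚ K * b)} =
    (W K b 0 1 ∩ Submodule.span ℤ (Set.range (fractionalIdealLatticeBasis K (FractionalIdeal.mk0 K J)))).ncard := by
  rw [← Nat.card_coe_set_eq]
  refine Nat.card_congr ((Equiv.subtypeSubtypeEquivSubtypeInter (fun a => a ∈ idealSet K J)
    (fun a => mixedEmbedding.norm a ≤ Real.exp (finrank ℚ K * b))).trans (Equiv.subtypeEquivProp ?_))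
  ext a
  have h1 : a ∈ idealSet K J ↔ a ∈ fundamentalCone K ∧
    a ∈ Submodule.span ℤ (Set.range (fractionalIdealLatticeBasis K (FractionalIdeal.mk0 K J))) := by
    rw [span_idealLatticeBasis]; rfl
  have h2 := cone_eq_W K b a
  have h3 : a ∈ (W K b 0 1 ∩ Submodule.span ℤ (Set.range (fractionalIdealLatticeBasis K (FractionalIdeal.mk0 K J))) : Set (mixedSpace K))
     ↔ a ∈ W K b 0 1 ∧ a ∈ Submodule.span ℤ (Set.range (fractionalIdealLatticeBasis K (FractionalIdeal.mk0 K J))) := Iff.rfl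
  show (a ∈ idealSet K J ∧ mixedEmbedding.norm a ≤ Real.exp (finrank ℚ K * b)) ↔ a ∈ (W K b 0 1 ∩ Submodule.span ℤ (Set.range (fractionalIdealLatticeBasis K (FractionalIdeal.mk0 K J))) : Set (mixedSpace K))
  rw [h3, h1, ← h2]
  tauto

lemma class_count (C : ClassGroup (𝓞 K)) : ∃ κ > 0, ∃ D, ∀ x : ℝ, 1 ≤ x →
    |(Nat.card {I : (Ideal (𝓞 K))⁰ // absNorm (I : Ideal (𝓞 K)) ≤ x ∧ ClassGroup.mk0 I = C} : ℝ) - κ * x|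
      ≤ D * x ^ (1 - 1 / (2 * finrank ℚ K) : ℝ) := by
  classical
  obtain ⟨J, hJ⟩ := ClassGroup.mk0_surjective C⁻¹
  have hN : (1:ℝ) ≤ absNorm J.1 := by exact_mod_cast (absNorm_pos_of_nonZeroDivisors J)
  set β := fractionalIdealLatticeBasis K (FractionalIdeal.mk0 K J) with hβ
  obtain ⟨D, hD⟩ := lattice_count K β
  set V := volume.real (ZSpan.fundamentalDomain β) with hV
  set v := volume.real (normLeOne K) with hv
  have hv0 : 0 < v := vol_pos K
  have hV0 : 0 < V := by
    rw [hV, Measure.real, ENNReal.toReal_pos_iff]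
    exact ⟨pos_iff_ne_zero.2 (ZSpan.measure_fundamentalDomain_ne_zero β),
      (ZSpan.fundamentalDomain_isBounded β).measure_lt_top⟩
  have hτ : (0:ℝ) < torsionOrder K := by exact_mod_cast Nat.pos_of_ne_zero (torsionOrder_ne_zero K)
  have hn : (0:ℝ) < finrank ℚ K := by exact_mod_cast (finrank_pos : 0 < finrank ℚ K)
  set N : ℝ := ((absNorm J.1 : ℕ) : ℝ)
  set n : ℝ := (finrank ℚ K : ℝ)
  refine ⟨v * N / (torsionOrder K * V), by positivity, D * N ^ (1 - 1 / (2 * n)) / (torsionOrder K * V), fun x hx => ?_⟩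
  have hs : 1 ≤ x * N := by nlinarith
  have hs0 : 0 < x * N := by linarith
  set b := Real.log (x * N) / n with hb
  have hb0 : 0 ≤ b := div_nonneg (Real.log_nonneg hs) hn.le
  have hnb : n * b = Real.log (x * N) := by rw [hb]; field_simp
  have e1 : Real.exp (n * b) = x * N := by rw [hnb, Real.exp_log hs0]
  have e2 : Real.exp (n * b - b / 2) = x ^ (1 - 1 / (2 * n)) * N ^ (1 - 1 / (2 * n)) := by
    rw [← Real.mul_rpow (by linarith) (by linarith), Real.rpow_def_of_pos hs0, ← hnb]
    congr 1; field_simp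
  have h1 := hD b hb0
  rw [← card_idealSet, e1, e2, ← card_isPrincipal_dvd_norm_le, ← aux1 K hJ, Nat.cast_mul] at h1
  set c : ℝ := (Nat.card {I : (Ideal (𝓞 K))⁰ // absNorm (I : Ideal (𝓞 K)) ≤ x ∧ ClassGroup.mk0 I = C} : ℝ)
  have h2 : c - v * N / (torsionOrder K * V) * x = (c * torsionOrder K * V - v * (x * N)) / (torsionOrder K * V) := by
    field_simp
  rw [h2, abs_div, abs_of_pos (by positivity : 0 < torsionOrder K * V), div_le_iff₀ (by positivity)]
  refine h1.trans (le_of_eq ?_)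
  field_simp

lemma card_le_eq_sum (x : ℝ) (hx : 0 ≤ x) :
    Nat.card {I : (Ideal (𝓞 K))⁰ // absNorm (I : Ideal (𝓞 K)) ≤ x} =
    ∑ C : ClassGroup (𝓞 K), Nat.card {I : (Ideal (𝓞 K))⁰ // absNorm (I : Ideal (𝓞 K)) ≤ x ∧ ClassGroup.mk0 I = C} := by
  classical
  have : Fintype {I : (Ideal (𝓞 K))⁰ // absNorm (I : Ideal (𝓞 K)) ≤ x} := by
    simp_rw [← Nat.le_floor_iff hx]
    refine @Fintype.ofFinite _ (finite_setOfPred_absNorm_le₀ ⌊x⌋₊)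
  let e := fun C : ClassGroup (𝓞 K) ↦ Equiv.subtypeSubtypeEquivSubtypeInter
      (fun I : (Ideal (𝓞 K))⁰ ↦ absNorm I.1 ≤ x) (fun I ↦ ClassGroup.mk0 I = C)
  simp_rw [← Nat.card_congr (e _), Nat.card_eq_fintype_card, Fintype.subtype_card]
  rw [Fintype.card, Finset.card_eq_sum_card_fiberwise (f := fun I ↦ ClassGroup.mk0 I.1)
      (t := Finset.univ) (fun _ _ ↦ Finset.mem_univ _)]

lemma sum_aK (x : ℝ) (hx : 0 ≤ x) : ∑ k ∈ Finset.Icc 1 ⌊x⌋₊, IdealVM.aK K k =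
    Nat.card {I : (Ideal (𝓞 K))⁰ // absNorm (I : Ideal (𝓞 K)) ≤ x} := by
  classical
  simp_rw [IdealVM.aK]
  rw [← Nat.cast_sum, ← Finset.card_biUnion]
  · rw [Nat.cast_inj, ← Fintype.card_coe, ← Nat.card_eq_fintype_card]
    refine Nat.card_congr ?_
    refine ⟨fun I => ⟨⟨I.1, ?_⟩, ?_⟩, fun I => ⟨I.1.1, ?_⟩, fun I => rfl, fun I => rfl⟩
    · obtain ⟨k, hk, hI⟩ := Finset.mem_biUnion.1 I.2
      rw [Finset.mem_Icc] at hk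
      exact mem_nonZeroDivisors_of_ne_zero (IdealVM.ne_zero_of_mem_F K (by omega) hI)
    · obtain ⟨k, hk, hI⟩ := Finset.mem_biUnion.1 I.2
      rw [Finset.mem_Icc, Nat.le_floor_iff hx] at hk
      rw [IdealVM.mem_F] at hI
      simpa only [hI] using hk.2
    · refine Finset.mem_biUnion.2 ⟨_, ?_, IdealVM.mem_F.2 rfl⟩
      rw [Finset.mem_Icc, Nat.le_floor_iff hx]
      exact ⟨absNorm_pos_of_nonZeroDivisors I.1, I.2⟩
  · intro i _ j _ hij
    rw [Function.onFun, Finset.disjoint_left]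
    intro I hI hI'
    rw [IdealVM.mem_F] at hI hI'
    exact hij (hI.symm.trans hI')

lemma ideal_count : ∃ κ > 0, ∃ D, ∀ x : ℝ, 1 ≤ x →
    |(∑ k ∈ Finset.Icc 1 ⌊x⌋₊, IdealVM.aK K k) - κ * x| ≤ D * x ^ (1 - 1 / (2 * finrank ℚ K) : ℝ) := by
  choose κ hκ D hD using class_count K
  refine ⟨∑ C, κ C, Finset.sum_pos (fun C _ => hκ C) Finset.univ_nonempty, ∑ C, D C, fun x hx => ?_⟩
  rw [sum_aK K x (by linarith), card_le_eq_sum K x (by linarith), Nat.cast_sum, Finset.sum_mul, Finset.sum_mul,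
    ← Finset.sum_sub_distrib]
  exact (Finset.abs_sum_le_sum_abs _ _).trans (Finset.sum_le_sum fun C _ => hD C x hx)

open Filter Topology in
theorem theta_field : Tendsto (fun x:ℝ => (∑ p ∈ Finset.Ioc 0 ⌊x⌋₊ with p.Prime, (Nat.card (𝓞 K →+* ZMod p) : ℝ) * Real.log p) / x) atTop (𝓝 1) := by
  obtain ⟨κ, hκ, D, hD⟩ := ideal_count K
  have hn : (0:ℝ) < finrank ℚ K := by exact_mod_cast (finrank_pos : 0 < finrank ℚ K)
  exact IdealVM.theta_of_count K κ D (1 / (2 * finrank ℚ K)) hκ (by positivity) hD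

end LatCount


namespace AlgPart
open NumberField

lemma card_eq_of_isog {C A : Type*} [CommRing C] [CommRing A] (i : C →+* A) (hi : Function.Injective i)
    (d : ℕ) (hd : ∀ a, ∃ c, i c = d * a) (p : ℕ) [Fact p.Prime] (hp : ¬ p ∣ d) :
    Nat.card (A →+* ZMod p) = Nat.card (C →+* ZMod p) := by
  have hd0 : (d : ZMod p) ≠ 0 := by rwa [Ne, ZMod.natCast_eq_zero_iff]
  refine Nat.card_congr (Equiv.ofBijective (fun ψ => ψ.comp i) ⟨?_, ?_⟩)
  · intro ψ ψ' h
    ext a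
    obtain ⟨c, hc⟩ := hd a
    have h1 : ψ (i c) = ψ' (i c) := by
      simpa using congrArg (fun g : C →+* ZMod p => g c) h
    rw [hc, map_mul, map_mul, map_natCast, map_natCast] at h1
    exact mul_left_cancel₀ hd0 h1
  · intro χ
    choose g hg using hd
    have key : ∀ c a, i c = d * a → χ c = χ (g a) := by
      intro c a h
      rw [hi (h.trans (hg a).symm)]
    refine ⟨{ toFun := fun a => χ (g a) / d, map_one' := ?_, map_mul' := ?_, map_zero' := ?_, map_add' := ?_ }, ?_⟩
    · rw [← key d 1 (by simp), map_natCast, div_self hd0]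
    · intro a b
      have : χ (d * g (a * b)) = χ (g a * g b) := by
        congr 1
        apply hi
        rw [map_mul, map_mul, hg, hg, hg, map_natCast]; ring
      rw [map_mul, map_mul, map_natCast] at this
      field_simp
      linear_combination this
    · rw [← key 0 0 (by simp), map_zero, zero_div]
    · intro a b
      rw [← key (g a + g b) (a + b) (by rw [map_add, hg, hg]; ring), map_add, add_div]
    · ext c
      show χ (g (i c)) / d = χ c
      rw [← key (d * c) (i c) (by simp), map_mul, map_natCast]
      field_simp

lemma card_pi {ι : Type} [Fintype ι] (A : ι → Type) [∀ i, CommRing (A i)] (F : Type) [Field F]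
    [∀ i, Finite (A i →+* F)] :
    Nat.card ((∀ i, A i) →+* F) = ∑ i, Nat.card (A i →+* F) := by
  classical
  rw [← Nat.card_sigma]
  refine (Nat.card_congr (Equiv.ofBijective
    (fun x : Σ i, (A i →+* F) => x.2.comp (Pi.evalRingHom A x.1)) ⟨?_, ?_⟩)).symm
  · rintro ⟨i, φ⟩ ⟨j, ψ⟩ h
    have h' : ∀ a : ∀ i, A i, φ (a i) = ψ (a j) := fun a => by
      simpa using congrArg (fun g : (∀ i, A i) →+* F => g a) h
    have hij : i = j := by
      by_contra hne
      have := h' (Pi.single i 1)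
      rw [Pi.single_eq_same, Pi.single_eq_of_ne (Ne.symm hne), map_one, map_zero] at this
      exact one_ne_zero this
    subst hij
    congr 1
    ext a
    simpa using h' (Pi.single i a)
  · intro χ
    have h1 : ∑ i, χ (Pi.single i 1) = 1 := by
      rw [← map_sum, Finset.univ_sum_single, ← map_one χ]; rfl
    obtain ⟨i, -, hi⟩ := Finset.exists_ne_zero_of_sum_ne_zero (by rw [h1]; exact one_ne_zero)
    have hi1 : χ (Pi.single i 1) = 1 := by
      have : χ (Pi.single i 1) * χ (Pi.single i 1) = χ (Pi.single i 1) * 1 := by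
        rw [← map_mul, ← Pi.single_mul, one_mul, mul_one]
      exact mul_left_cancel₀ hi this
    have hmul : ∀ a b : A i, χ (Pi.single i (a * b)) = χ (Pi.single i a) * χ (Pi.single i b) :=
      fun a b => by rw [Pi.single_mul, map_mul]
    have hzero : χ (Pi.single i 0) = 0 := by rw [Pi.single_zero, map_zero]
    have hadd : ∀ a b : A i, χ (Pi.single i (a + b)) = χ (Pi.single i a) + χ (Pi.single i b) :=
      fun a b => by rw [Pi.single_add, map_add]
    let ψ : A i →+* F :=
      { toFun := fun b => χ (Pi.single i b)
        map_one' := hi1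
        map_mul' := hmul
        map_zero' := hzero
        map_add' := hadd }
    refine ⟨⟨i, ψ⟩, ?_⟩
    refine RingHom.ext fun a => ?_
    show χ (Pi.single i (a i)) = χ a
    have : Pi.single i (a i) = a * Pi.single i 1 := by
      ext j
      by_cases h : j = i
      · subst h; simp
      · simp [Pi.single_eq_of_ne h]
    rw [this, map_mul, hi1, mul_one]

lemma finite_hom (A : Type) [CommRing A] [Module.Finite ℤ A] (F : Type) [CommRing F] [Finite F] :
    Finite (A →+* F) := by
  obtain ⟨s, hs⟩ := Module.Finite.fg_top (R := ℤ) (M := A)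
  refine Finite.of_injective (fun φ : A →+* F => fun x : s => φ x) ?_
  intro φ ψ h
  have h2 : φ.toAddMonoidHom.toIntLinearMap = ψ.toAddMonoidHom.toIntLinearMap := by
    apply LinearMap.ext_on hs
    intro x hx
    exact congrFun h ⟨x, hx⟩
  ext a
  exact congrArg (fun g : A →ₗ[ℤ] F => g a) h2

/-- comparison of an order with the maximal order in a product of number fields -/
lemma order_card {ι : Type} [Fintype ι] (L : ι → Type) [∀ i, Field (L i)] [∀ i, NumberField (L i)]
    {C : Type} [CommRing C] (j : C →+* ∀ i, L i) (hj : Function.Injective j)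
    (hint : ∀ c : C, IsIntegral ℤ c) (hden : ∀ e : ∀ i, L i, ∃ d : ℕ, d ≠ 0 ∧ ∃ c, j c = d * e) :
    ∃ D : ℕ, D ≠ 0 ∧ ∀ p : ℕ, p.Prime → ¬ p ∣ D →
      Nat.card (C →+* ZMod p) = ∑ i, Nat.card (𝓞 (L i) →+* ZMod p) := by
  classical
  let q : C →+* ∀ i, 𝓞 (L i) := RingHom.pi fun i =>
    (((Pi.evalRingHom L i).comp j).codRestrict (integralClosure ℤ (L i)).toSubring fun c =>
      (hint c).map ((Pi.evalRingHom L i).comp j).toIntAlgHom)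
  have hq : ∀ c i, ((q c i : 𝓞 (L i)) : L i) = j c i := fun c i => rfl
  have hqi : Function.Injective q := by
    intro c c' h
    apply hj
    ext i
    rw [← hq, ← hq, h]
  have hloc : ∀ a : ∀ i, 𝓞 (L i), ∃ d : ℕ, d ≠ 0 ∧ ∃ c, q c = d * a := by
    intro a
    obtain ⟨d, hd, c, hc⟩ := hden (fun i => (a i : L i))
    refine ⟨d, hd, c, ?_⟩
    ext i
    rw [hq, hc]; simp
  obtain ⟨s, hs⟩ := Module.Finite.fg_top (R := ℤ) (M := ∀ i, 𝓞 (L i))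
  choose d hd g hg using hloc
  refine ⟨∏ a ∈ s, d a, Finset.prod_ne_zero_iff.2 fun a _ => hd a, fun p hp hpD => ?_⟩
  have := Fact.mk hp
  have hfin : ∀ i, Finite (𝓞 (L i) →+* ZMod p) := fun i => finite_hom _ _
  rw [← card_pi, card_eq_of_isog q hqi (∏ a ∈ s, d a) ?_ p hpD]
  intro a
  have ha : a ∈ Submodule.span ℤ (s : Set (∀ i, 𝓞 (L i))) := by rw [hs]; trivial
  induction ha using Submodule.span_induction with
  | mem x hx =>
    refine ⟨(∏ a ∈ s.erase x, d a : ℕ) * g x, ?_⟩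
    rw [map_mul, hg, map_natCast, ← Finset.mul_prod_erase s d hx]; push_cast; ring
  | zero => exact ⟨0, by simp⟩
  | add x y _ _ hx hy =>
    obtain ⟨c, hc⟩ := hx
    obtain ⟨c', hc'⟩ := hy
    exact ⟨c + c', by rw [map_add, hc, hc']; ring⟩
  | smul n x _ hx =>
    obtain ⟨c, hc⟩ := hx
    exact ⟨n • c, by rw [map_zsmul, hc, mul_smul_comm]⟩

end AlgPart


namespace AlgPart
open NumberField Polynomial

/-- number of roots of `g` modulo `p` -/
noncomputable def rootCount (g : ℤ[X]) (p : ℕ) : ℕ :=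
  Nat.card {a : ZMod p // eval₂ (Int.castRingHom (ZMod p)) a g = 0}

lemma exists_den (K : Type) [Field K] [NumberField K] (a : K) :
    ∃ d : ℕ, d ≠ 0 ∧ ∃ b : 𝓞 K, (b : K) = d * a := by
  have ha : IsAlgebraic ℤ a := by
    rw [IsFractionRing.isAlgebraic_iff ℤ ℚ K]
    exact Algebra.IsAlgebraic.isAlgebraic a
  obtain ⟨y, hy, hi⟩ := ha.exists_integral_multiple
  refine ⟨y.natAbs, Int.natAbs_ne_zero.2 hy, ?_⟩
  have : IsIntegral ℤ ((y.natAbs : K) * a) := by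
    have h2 : ((y.natAbs : K) * a) = y.sign • (y • a) := by
      rw [smul_smul, Int.sign_mul_self_eq_natAbs, zsmul_eq_mul]
      simp
    rw [h2]
    exact hi.smul _
  exact ⟨⟨_, this⟩, rfl⟩

lemma card_adjoin (R : Type) [CommRing R] (g : ℤ[X]) (p : ℕ) :
    Nat.card (AdjoinRoot (g.map (algebraMap ℤ R)) →+* ZMod p) =
      Nat.card (R →+* ZMod p) * rootCount g p := by
  rw [rootCount, ← Nat.card_prod]
  have key : ∀ (φ : R →+* ZMod p) (a : ZMod p), eval₂ φ a (g.map (algebraMap ℤ R)) =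
      eval₂ (Int.castRingHom (ZMod p)) a g := by
    intro φ a
    rw [eval₂_map]
    congr 1
    exact RingHom.ext_int _ _
  refine Nat.card_congr
    { toFun := fun ψ => (ψ.comp (AdjoinRoot.of _), ⟨ψ (AdjoinRoot.root _), ?_⟩)
      invFun := fun x => AdjoinRoot.lift x.1 x.2.1 (by rw [key]; exact x.2.2)
      left_inv := ?_
      right_inv := ?_ }
  · rw [← key (ψ.comp (AdjoinRoot.of _)), ← hom_eval₂, AdjoinRoot.eval₂_root, map_zero]
  · intro ψ
    apply AdjoinRoot.ringHom_ext
    · simp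
    · simp
  · rintro ⟨φ, a, ha⟩
    simp

/-- comparison map -/
lemma mul_card (K : Type) [Field K] [NumberField K] (g : ℤ[X]) (hg : g.Monic)
    {ι : Type} [Fintype ι] (L : ι → Type) [∀ i, Field (L i)] [∀ i, NumberField (L i)]
    (e : AdjoinRoot (g.map (algebraMap ℤ K)) ≃+* ∀ i, L i) :
    ∃ D : ℕ, D ≠ 0 ∧ ∀ p : ℕ, p.Prime → ¬ p ∣ D →
      Nat.card (𝓞 K →+* ZMod p) * rootCount g p = ∑ i, Nat.card (𝓞 (L i) →+* ZMod p) := by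
  have hmap : g.map (algebraMap ℤ K) = (g.map (algebraMap ℤ (𝓞 K))).map (algebraMap (𝓞 K) K) := by
    rw [map_map]; congr 1
  let j0 : AdjoinRoot (g.map (algebraMap ℤ (𝓞 K))) →+* AdjoinRoot (g.map (algebraMap ℤ K)) :=
    AdjoinRoot.map (algebraMap (𝓞 K) K) _ _ (by rw [← hmap])
  have hj0 : ∀ q : (𝓞 K)[X], j0 (AdjoinRoot.mk _ q) = AdjoinRoot.mk _ (q.map (algebraMap (𝓞 K) K)) := by
    intro q
    have : j0.comp (AdjoinRoot.mk _) = (AdjoinRoot.mk _).comp (mapRingHom (algebraMap (𝓞 K) K)) := by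
      apply Polynomial.ringHom_ext
      · intro a
        simp [j0]
      · simp [j0]
    exact congrArg (fun h : (𝓞 K)[X] →+* _ => h q) this
  have hmon : (g.map (algebraMap ℤ (𝓞 K))).Monic := hg.map _
  have hinj : Function.Injective j0 := by
    rw [injective_iff_map_eq_zero]
    intro c hc
    obtain ⟨q, rfl⟩ := AdjoinRoot.mk_surjective c
    rw [hj0, AdjoinRoot.mk_eq_zero, hmap, map_dvd_map _ (RingOfIntegers.coe_injective) hmon] at hc
    exact AdjoinRoot.mk_eq_zero.2 hc
  have hden : ∀ x, ∃ d : ℕ, d ≠ 0 ∧ ∃ c, j0 c = d * x := by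
    intro x
    obtain ⟨q, rfl⟩ := AdjoinRoot.mk_surjective x
    induction q using Polynomial.induction_on' with
    | add q r hq hr =>
      obtain ⟨d, hd, c, hc⟩ := hq
      obtain ⟨d', hd', c', hc'⟩ := hr
      refine ⟨d * d', mul_ne_zero hd hd', d' * c + d * c', ?_⟩
      rw [map_add, map_mul, map_mul, hc, hc', map_add, map_natCast, map_natCast]
      push_cast; ring
    | monomial n a =>
      obtain ⟨d, hd, b, hb⟩ := exists_den K a
      refine ⟨d, hd, AdjoinRoot.mk _ (monomial n b), ?_⟩
      rw [hj0, map_monomial, ← map_natCast (AdjoinRoot.mk _), ← map_mul, show algebraMap (𝓞 K) K b = d * a from hb,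
        ← C_mul_X_pow_eq_monomial, ← C_mul_X_pow_eq_monomial, C_mul, mul_assoc]
      simp
  have hint : ∀ c : AdjoinRoot (g.map (algebraMap ℤ (𝓞 K))), IsIntegral ℤ c := by
    intro c
    have := hmon.finite_adjoinRoot
    have h1 : IsIntegral (𝓞 K) c := Algebra.IsIntegral.isIntegral c
    exact isIntegral_trans (R := ℤ) c h1
  obtain ⟨D, hD, h⟩ := order_card L (e.toRingHom.comp j0) (e.injective.comp hinj) hint (by
    intro y
    obtain ⟨d, hd, c, hc⟩ := hden (e.symm y)
    refine ⟨d, hd, c, ?_⟩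
    simp [hc])
  refine ⟨D, hD, fun p hp hpD => ?_⟩
  rw [← h p hp hpD, card_adjoin]

lemma exists_decomp (K : Type) [Field K] [NumberField K] (g : ℤ[X]) (hg : g.Monic)
    (hsep : (g.map (Int.castRingHom ℚ)).Separable) :
    ∃ (ι : Type) (_ : Fintype ι) (L : ι → Type) (_ : ∀ i, Field (L i)) (_ : ∀ i, NumberField (L i)),
      Nonempty (AdjoinRoot (g.map (algebraMap ℤ K)) ≃+* ∀ i, L i) := by
  have hsep' : (g.map (algebraMap ℤ K)).Separable := by
    have h1 := hsep.map (f := algebraMap ℚ K)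
    have h2 : g.map (algebraMap ℤ K) = (g.map (Int.castRingHom ℚ)).map (algebraMap ℚ K) := by
      rw [map_map]
      congr 1
      exact RingHom.ext_int _ _
    rwa [h2]
  have : Module.Finite K (AdjoinRoot (g.map (algebraMap ℤ K))) := (hg.map _).finite_adjoinRoot
  have : IsArtinianRing (AdjoinRoot (g.map (algebraMap ℤ K))) := IsArtinianRing.of_finite K _
  have : IsReduced (AdjoinRoot (g.map (algebraMap ℤ K))) :=
    (Ideal.isRadical_iff_quotient_reduced _).mp
      (isRadical_iff_span_singleton.mp hsep'.squarefree.isRadical)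
  let E := AdjoinRoot (g.map (algebraMap ℤ K))
  let F : ∀ M : MaximalSpectrum E, Field (E ⧸ M.asIdeal) := fun M => Ideal.Quotient.field _
  refine ⟨MaximalSpectrum E, Fintype.ofFinite _, fun M => E ⧸ M.asIdeal, F, ?_,
    ⟨(IsArtinianRing.equivPi E).toRingEquiv⟩⟩
  intro M
  have hfin : Module.Finite K (E ⧸ M.asIdeal) := inferInstance
  let := F M
  exact NumberField.of_module_finite K (E ⧸ M.asIdeal)

lemma two_le_card (K : Type) [Field K] (G : K[X]) (hdeg : 2 ≤ G.natDegree) (r : K) (hr : G.IsRoot r)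
    {ι : Type} [Fintype ι] (L : ι → Type) [∀ i, Field (L i)]
    (e : AdjoinRoot G ≃+* ∀ i, L i) : 2 ≤ Fintype.card ι := by
  by_contra hlt
  have hG0 : G ≠ 0 := by rintro rfl; simp at hdeg
  have hdeg0 : G.degree ≠ 0 := by
    rw [degree_eq_natDegree hG0]; norm_cast; omega
  have hnt : Nontrivial (AdjoinRoot G) := AdjoinRoot.nontrivial G hdeg0
  have hnt2 : Nontrivial (∀ i, L i) := e.injective.nontrivial
  have : Nonempty ι := by
    by_contra h
    rw [not_nonempty_iff] at h
    exact not_subsingleton (∀ i, L i) inferInstance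
  have h1 : Fintype.card ι = 1 := by
    have := Fintype.card_pos (α := ι); omega
  obtain ⟨i, hi⟩ := Fintype.card_eq_one_iff.1 h1
  let : Unique ι := ⟨⟨i⟩, hi⟩
  let e' : AdjoinRoot G ≃+* L default := e.trans (RingEquiv.piUnique L)
  have hdom : IsDomain (AdjoinRoot G) := e'.toMulEquiv.isDomain
  obtain ⟨q, hq⟩ := dvd_iff_isRoot.2 hr
  have h0 : AdjoinRoot.mk G (X - C r) * AdjoinRoot.mk G q = 0 := by
    rw [← map_mul, ← hq, AdjoinRoot.mk_self]
  have hq0 : q ≠ 0 := by rintro rfl; simp at hq; exact hG0 hq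
  have hnd : G.natDegree = 1 + q.natDegree := by
    conv_lhs => rw [hq]
    rw [natDegree_mul (X_sub_C_ne_zero r) hq0, natDegree_X_sub_C]
  rcases mul_eq_zero.1 h0 with h | h
  · have := natDegree_le_of_dvd (AdjoinRoot.mk_eq_zero.1 h) (X_sub_C_ne_zero r)
    rw [natDegree_X_sub_C] at this; omega
  · have := natDegree_le_of_dvd (AdjoinRoot.mk_eq_zero.1 h) hq0
    omega

lemma card_rat (p : ℕ) : Nat.card (𝓞 ℚ →+* ZMod p) = 1 := by
  rw [Nat.card_eq_one_iff_unique]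
  constructor
  · constructor
    intro φ ψ
    have : φ.comp Rat.ringOfIntegersEquiv.symm.toRingHom = ψ.comp Rat.ringOfIntegersEquiv.symm.toRingHom :=
      RingHom.ext_int _ _
    ext a
    have h2 : φ (Rat.ringOfIntegersEquiv.symm (Rat.ringOfIntegersEquiv a)) =
        ψ (Rat.ringOfIntegersEquiv.symm (Rat.ringOfIntegersEquiv a)) :=
      congrArg (fun h : ℤ →+* ZMod p => h (Rat.ringOfIntegersEquiv a)) this
    rwa [RingEquiv.symm_apply_apply] at h2
  · exact ⟨(Int.castRingHom _).comp Rat.ringOfIntegersEquiv.toRingHom⟩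

end AlgPart


namespace AlgPart
open NumberField Polynomial Filter Topology

/-- log-weighted mean over the primes -/
def HasLogMean (c : ℕ → ℝ) (m : ℝ) : Prop :=
  Tendsto (fun x : ℝ => (∑ p ∈ Finset.Ioc 0 ⌊x⌋₊ with p.Prime, c p * Real.log p) / x) atTop (𝓝 m)

lemma HasLogMean.add {c c' : ℕ → ℝ} {m m' : ℝ} (h : HasLogMean c m) (h' : HasLogMean c' m') :
    HasLogMean (fun p => c p + c' p) (m + m') := by
  refine (Tendsto.add h h').congr fun x => ?_
  rw [← add_div, ← Finset.sum_add_distrib]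
  congr 1
  exact Finset.sum_congr rfl fun p _ => by ring

lemma HasLogMean.const_mul {c : ℕ → ℝ} {m : ℝ} (a : ℝ) (h : HasLogMean c m) :
    HasLogMean (fun p => a * c p) (a * m) := by
  refine (Tendsto.const_mul a h).congr fun x => ?_
  rw [← mul_div_assoc, Finset.mul_sum]
  congr 1
  exact Finset.sum_congr rfl fun p _ => by ring

lemma hasLogMean_zero : HasLogMean (fun _ => 0) 0 := by
  simp [HasLogMean]

lemma HasLogMean.sum {ι : Type*} (s : Finset ι) {c : ι → ℕ → ℝ} {m : ι → ℝ}
    (h : ∀ i ∈ s, HasLogMean (c i) (m i)) :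
    HasLogMean (fun p => ∑ i ∈ s, c i p) (∑ i ∈ s, m i) := by
  classical
  induction s using Finset.induction_on with
  | empty => simpa using hasLogMean_zero
  | insert i s hi ih =>
    simp only [Finset.sum_insert hi]
    exact (h i (Finset.mem_insert_self i s)).add
      (ih fun j hj => h j (Finset.mem_insert_of_mem hj))

lemma HasLogMean.congr {c c' : ℕ → ℝ} {m : ℝ} (h : HasLogMean c m) (D : ℕ) (hD : D ≠ 0)
    (hc : ∀ p : ℕ, p.Prime → ¬ p ∣ D → c p = c' p) : HasLogMean c' m := by
  have h0 : HasLogMean (fun p => c' p - c p) 0 := by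
    have hlim : Tendsto (fun x : ℝ => (∑ p ∈ Finset.Ioc 0 D with p.Prime,
        (c' p - c p) * Real.log p) / x) atTop (𝓝 0) := tendsto_id.const_div_atTop _
    refine hlim.congr' ?_
    filter_upwards [eventually_ge_atTop (D : ℝ)] with x hx
    congr 1
    refine Finset.sum_subset ?_ ?_
    · intro p hp
      simp only [Finset.mem_filter, Finset.mem_Ioc] at hp ⊢
      exact ⟨⟨hp.1.1, hp.1.2.trans (Nat.le_floor hx)⟩, hp.2⟩
    · intro p hp hp'
      simp only [Finset.mem_filter, Finset.mem_Ioc] at hp hp'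
      rw [hc p hp.2 fun hd => hp' ⟨⟨hp.1.1, Nat.le_of_dvd (Nat.pos_of_ne_zero hD) hd⟩, hp.2⟩]
      simp
  have := h.add h0
  simpa using this

lemma HasLogMean.le {c c' : ℕ → ℝ} {m m' : ℝ} (h : HasLogMean c m) (h' : HasLogMean c' m')
    (hle : ∀ p : ℕ, p.Prime → c p ≤ c' p) : m ≤ m' := by
  refine le_of_tendsto_of_tendsto h h' ?_
  filter_upwards [eventually_gt_atTop 0] with x hx
  refine div_le_div_of_nonneg_right (Finset.sum_le_sum fun p hp => ?_) hx.le
  exact mul_le_mul_of_nonneg_right (hle p (Finset.mem_filter.1 hp).2) (Real.log_natCast_nonneg p)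

lemma hasLogMean_field (K : Type) [Field K] [NumberField K] :
    HasLogMean (fun p => (Nat.card (𝓞 K →+* ZMod p) : ℝ)) 1 := LatCount.theta_field K

lemma moments (g : ℤ[X]) (hg : g.Monic) (hsep : (g.map (Int.castRingHom ℚ)).Separable) (k : ℕ) :
    ∀ (K : Type) [Field K] [NumberField K], ∃ m : ℝ,
      HasLogMean (fun p => (Nat.card (𝓞 K →+* ZMod p) : ℝ) * (rootCount g p : ℝ) ^ k) m := by
  induction k with
  | zero =>
    intro K _ _
    exact ⟨1, by simpa using hasLogMean_field K⟩
  | succ k ih =>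
    intro K _ _
    obtain ⟨ι, _, L, _, _, ⟨e⟩⟩ := exists_decomp K g hg hsep
    obtain ⟨D, hD, h⟩ := mul_card K g hg L e
    choose m hm using fun i => ih (L i)
    refine ⟨∑ i, m i, (HasLogMean.sum Finset.univ fun i _ => hm i).congr D hD fun p hp hpD => ?_⟩
    rw [← Finset.sum_mul, ← Nat.cast_sum, ← h p hp hpD]
    push_cast
    ring

lemma moments_rat (g : ℤ[X]) (hg : g.Monic) (hirr : Irreducible (g.map (Int.castRingHom ℚ)))
    (hdeg : 2 ≤ g.natDegree) :
    HasLogMean (fun _ => 1) 1 ∧ HasLogMean (fun p => (rootCount g p : ℝ)) 1 ∧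
    (∃ m : ℝ, 2 ≤ m ∧ HasLogMean (fun p => (rootCount g p : ℝ) ^ 2) m) ∧
    (∀ k, ∃ m, HasLogMean (fun p => (rootCount g p : ℝ) ^ k) m) := by
  have hsep := hirr.separable
  refine ⟨?_, ?_⟩
  · simpa [card_rat] using hasLogMean_field ℚ
  have hirr' : Irreducible (g.map (algebraMap ℤ ℚ)) := hirr
  have hF : Fact (Irreducible (g.map (algebraMap ℤ ℚ))) := ⟨hirr'⟩
  let L := AdjoinRoot (g.map (algebraMap ℤ ℚ))
  have : Module.Finite ℚ L := (hg.map _).finite_adjoinRoot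
  have : NumberField L := NumberField.of_module_finite ℚ L
  obtain ⟨D, hD, h⟩ := mul_card ℚ g hg (fun _ : Unit => L) (RingEquiv.piUnique (fun _ : Unit => L)).symm
  simp only [card_rat, one_mul, Finset.univ_unique, Finset.sum_const, Finset.card_singleton,
    one_smul] at h
  refine ⟨(hasLogMean_field L).congr D hD fun p hp hpD => by rw [h p hp hpD], ?_, ?_⟩
  · obtain ⟨ι, _, L', _, _, ⟨e⟩⟩ := exists_decomp L g hg hsep
    obtain ⟨D', hD', h'⟩ := mul_card L g hg L' e
    have hroot : (g.map (algebraMap ℤ L)).IsRoot (AdjoinRoot.root (g.map (algebraMap ℤ ℚ))) := by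
      have h1 := AdjoinRoot.eval₂_root (g.map (algebraMap ℤ ℚ))
      rw [eval₂_map] at h1
      rw [IsRoot.def, eval_map, ← h1]
      congr 1
    have h2 : 2 ≤ Fintype.card ι :=
      two_le_card L (g.map (algebraMap ℤ L)) (by rw [hg.natDegree_map]; exact hdeg) _ hroot L' e
    refine ⟨Fintype.card ι, by exact_mod_cast h2, ?_⟩
    have := (HasLogMean.sum Finset.univ fun i _ => hasLogMean_field (L' i)).congr
      (c' := fun p => (rootCount g p : ℝ) ^ 2) (D * D') (mul_ne_zero hD hD') (fun p hp hpD => by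
        rw [← Nat.cast_sum, ← h' p hp fun hd => hpD (hd.mul_left _),
          ← h p hp fun hd => hpD (hd.mul_right _)]
        push_cast; ring)
    simpa using this
  · intro k
    simpa [card_rat] using moments g hg hsep k ℚ

lemma rootCount_le (g : ℤ[X]) (hg : g.Monic) (p : ℕ) (hp : p.Prime) : rootCount g p ≤ g.natDegree := by
  classical
  have := Fact.mk hp
  have hm : (g.map (Int.castRingHom (ZMod p))).Monic := hg.map _
  have h1 : rootCount g p = (g.map (Int.castRingHom (ZMod p))).roots.toFinset.card := by
    rw [rootCount]
    refine Nat.subtype_card _ fun a => ?_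
    rw [Multiset.mem_toFinset, mem_roots hm.ne_zero, IsRoot.def, eval_map]
  rw [h1, ← hg.natDegree_map (Int.castRingHom (ZMod p))]
  exact (Multiset.toFinset_card_le _).trans (card_roots' _)

open Classical in
lemma indicator_mean (g : ℤ[X]) (hg : g.Monic) (hirr : Irreducible (g.map (Int.castRingHom ℚ)))
    (hdeg : 2 ≤ g.natDegree) :
    ∃ δ : ℝ, 0 < δ ∧ HasLogMean (fun p => if rootCount g p = 0 then 1 else 0) δ := by
  obtain ⟨h0, h1, ⟨m2, hm2, h2⟩, hk⟩ := moments_rat g hg hirr hdeg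
  choose m hm using hk
  set n := g.natDegree with hn
  let P : ℝ[X] := ∏ j ∈ Finset.Icc 1 n, (1 - C ((j : ℝ)⁻¹) * X)
  have hP : ∀ N : ℕ, N ≤ n → P.eval (N : ℝ) = if N = 0 then 1 else 0 := by
    intro N hN
    simp only [P, eval_prod, eval_sub, eval_one, eval_mul, eval_C, eval_X]
    split_ifs with h
    · simp [h]
    · apply Finset.prod_eq_zero (Finset.mem_Icc.2 ⟨Nat.pos_of_ne_zero h, hN⟩)
      rw [inv_mul_cancel₀ (by exact_mod_cast h), sub_self]
  have hind : HasLogMean (fun p => if rootCount g p = 0 then 1 else 0)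
      (∑ k ∈ Finset.range (P.natDegree + 1), P.coeff k * m k) := by
    refine (HasLogMean.sum (Finset.range (P.natDegree + 1)) fun k _ =>
      (hm k).const_mul (P.coeff k)).congr 1 one_ne_zero fun p hp _ => ?_
    rw [← hP _ (rootCount_le g hg p hp), eval_eq_sum_range]
  refine ⟨_, ?_, hind⟩
  set δ := ∑ k ∈ Finset.range (P.natDegree + 1), P.coeff k * m k
  have hle := (h2.add (h1.const_mul (-2) |>.add h0)).le
    ((h1.const_mul ((n : ℝ) - 1)).add ((h0.const_mul (1 - (n : ℝ))).add (hind.const_mul (n : ℝ)))) (by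
    intro p hp
    have hN := rootCount_le g hg p hp
    rw [← hn] at hN
    split_ifs with h
    · simp [h]
    · have h3 : (1 : ℝ) ≤ rootCount g p := by exact_mod_cast Nat.pos_of_ne_zero h
      have h4 : (rootCount g p : ℝ) ≤ n := by exact_mod_cast hN
      nlinarith [mul_nonneg (sub_nonneg.2 h3) (sub_nonneg.2 h4)])
  have hn0 : (0 : ℝ) < n := by exact_mod_cast (by omega : 0 < n)
  have : 0 < n * δ := by linarith
  exact (mul_pos_iff_of_pos_left hn0).1 this

end AlgPart


namespace AlgPart
open NumberField Polynomial Filter Topology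

lemma normalize (f : ℤ[X]) (hirr : Irreducible (f.map (Int.castRingHom ℚ))) (hdeg : 2 ≤ f.natDegree) :
    ∃ g : ℤ[X], g.Monic ∧ Irreducible (g.map (Int.castRingHom ℚ)) ∧ 2 ≤ g.natDegree ∧
      ∃ D : ℕ, D ≠ 0 ∧ ∀ p : ℕ, p.Prime → ¬ p ∣ D →
        (rootCount g p = 0 ↔ ∀ a : ℤ, ¬ (p : ℤ) ∣ f.eval a) := by
  have hf0 : f ≠ 0 := by rintro rfl; simp at hdeg
  have hl0 : f.leadingCoeff ≠ 0 := leadingCoeff_ne_zero.2 hf0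
  have hlQ : (f.leadingCoeff : ℚ) ≠ 0 := by exact_mod_cast hl0
  refine ⟨f.integralNormalization, monic_integralNormalization hf0, ?_,
    by rwa [natDegree_integralNormalization], f.leadingCoeff.natAbs, Int.natAbs_ne_zero.2 hl0, ?_⟩
  · let : Invertible ((f.leadingCoeff : ℚ)⁻¹) := invertibleOfNonzero (inv_ne_zero hlQ)
    have h1 := (MulEquiv.irreducible_iff (algEquivCMulXAddC ((f.leadingCoeff : ℚ)⁻¹) 0)).2 hirr
    refine (Associated.irreducible_iff ?_).1 h1
    have h2 : f.integralNormalization.map (Int.castRingHom ℚ) * C (f.leadingCoeff : ℚ) =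
        C ((f.leadingCoeff : ℚ) ^ f.natDegree) *
          algEquivCMulXAddC ((f.leadingCoeff : ℚ)⁻¹) 0 (f.map (Int.castRingHom ℚ)) := by
      have := congrArg (Polynomial.map (Int.castRingHom ℚ)) (integralNormalization_mul_C_leadingCoeff f)
      rw [Polynomial.map_mul, map_C] at this
      refine Eq.trans this ?_
      ext i
      rw [algEquivCMulXAddC_apply, ← comp_eq_aeval, C_0, add_zero, coeff_C_mul, comp_C_mul_X_coeff,
        coeff_map, coeff_map, coeff_scaleRoots]
      by_cases hi : i ≤ f.natDegree
      · simp only [eq_intCast, Int.cast_mul, Int.cast_pow]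
        rw [pow_sub₀ _ hlQ hi, inv_pow]; ring
      · rw [coeff_eq_zero_of_natDegree_lt (by omega)]; simp
    have hu1 : IsUnit (C (f.leadingCoeff : ℚ)) := isUnit_C.2 (isUnit_iff_ne_zero.2 hlQ)
    have hu2 : IsUnit (C ((f.leadingCoeff : ℚ) ^ f.natDegree)) :=
      isUnit_C.2 (isUnit_iff_ne_zero.2 (pow_ne_zero _ hlQ))
    refine ((associated_isUnit_mul_left_iff hu2).1 ?_)
    rw [← h2]
    exact (associated_mul_isUnit_left_iff hu1).2 (Associated.refl _)
  · intro p hp hpD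
    have := Fact.mk hp
    have hlp : (f.leadingCoeff : ZMod p) ≠ 0 := by
      rw [Ne, ZMod.intCast_zmod_eq_zero_iff_dvd]
      rwa [Int.natCast_dvd]
    have key : ∀ x : ZMod p, eval₂ (Int.castRingHom (ZMod p)) (f.leadingCoeff * x) f.integralNormalization
        * f.leadingCoeff = (f.leadingCoeff : ZMod p) ^ f.natDegree * eval₂ (Int.castRingHom (ZMod p)) x f := by
      intro x
      have h3 := scaleRoots_eval₂_mul (p := f) (Int.castRingHom (ZMod p)) x f.leadingCoeff
      rw [← integralNormalization_mul_C_leadingCoeff, eval₂_mul, eval₂_C] at h3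
      exact h3
    have hcast : ∀ a : ℤ, eval₂ (Int.castRingHom (ZMod p)) (a : ZMod p) f = ((f.eval a : ℤ) : ZMod p) := by
      intro a
      simp
    rw [rootCount, Nat.card_eq_zero, or_iff_left (not_infinite_iff_finite.2 inferInstance)]
    constructor
    · intro he a ha
      refine he.false ⟨f.leadingCoeff * (a : ZMod p), ?_⟩
      have h4 := key a
      rw [hcast, (ZMod.intCast_zmod_eq_zero_iff_dvd _ _).2 ha, mul_zero] at h4
      exact (mul_eq_zero.1 h4).resolve_right hlp
    · intro ha
      refine ⟨fun b => ?_⟩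
      obtain ⟨b, hb⟩ := b
      obtain ⟨a, ha'⟩ := ZMod.intCast_surjective (b / (f.leadingCoeff : ZMod p))
      apply ha a
      rw [← ZMod.intCast_zmod_eq_zero_iff_dvd, ← hcast, ha']
      have h4 := key (b / (f.leadingCoeff : ZMod p))
      rw [mul_div_cancel₀ _ hlp, hb, zero_mul] at h4
      exact (mul_eq_zero.1 h4.symm).resolve_left (pow_ne_zero _ hlp)

lemma count_of_mean {c : ℕ → ℝ} {δ : ℝ} (h : HasLogMean c δ) (hc0 : ∀ p, 0 ≤ c p) (hc1 : ∀ p, c p ≤ 1) :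
    Tendsto (fun x : ℝ => (∑ p ∈ Finset.Ioc 0 ⌊x⌋₊ with p.Prime, c p) * Real.log x / x) atTop (𝓝 δ) := by
  have hloglog : Tendsto (fun x : ℝ => Real.log (Real.log x) / Real.log x) atTop (𝓝 0) :=
    (Real.isLittleO_log_id_atTop.tendsto_div_nhds_zero).comp Real.tendsto_log_atTop
  have hU : Tendsto (fun x : ℝ => (Real.log x)⁻¹ +
      ((∑ p ∈ Finset.Ioc 0 ⌊x⌋₊ with p.Prime, c p * Real.log p) / x) *
        (1 - 2 * (Real.log (Real.log x) / Real.log x))⁻¹) atTop (𝓝 δ) := by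
    have h1 : Tendsto (fun x : ℝ => (1 - 2 * (Real.log (Real.log x) / Real.log x))⁻¹) atTop (𝓝 1) := by
      have := ((hloglog.const_mul 2).const_sub 1).inv₀ (by norm_num)
      simpa using this
    have := (Real.tendsto_log_atTop.inv_tendsto_atTop).add (Tendsto.mul h h1)
    simpa using this
  have hsmall : ∀ᶠ x : ℝ in atTop, Real.log (Real.log x) / Real.log x < 1 / 2 :=
    hloglog.eventually_lt_const (by norm_num)
  refine tendsto_of_tendsto_of_tendsto_of_le_of_le' h hU ?_ ?_
  · filter_upwards [eventually_gt_atTop 1] with x hx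
    refine div_le_div_of_nonneg_right ?_ (by linarith)
    rw [Finset.sum_mul]
    refine Finset.sum_le_sum fun p hp => mul_le_mul_of_nonneg_left ?_ (hc0 p)
    simp only [Finset.mem_filter, Finset.mem_Ioc] at hp
    exact Real.log_le_log (by exact_mod_cast hp.1.1) ((Nat.le_floor_iff (by linarith)).1 hp.1.2)
  · filter_upwards [eventually_gt_atTop 1, hsmall, Real.tendsto_log_atTop.eventually_gt_atTop 1]
      with x hx hs hl
    have hx0 : 0 < x := by linarith
    have hl0 : 0 < Real.log x := by linarith
    set l := Real.log x with hldef
    set y := x / l ^ 2 with hy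
    have hy0 : 0 < y := by positivity
    have hlogy : Real.log y = l * (1 - 2 * (Real.log l / l)) := by
      rw [hy, Real.log_div hx0.ne' (by positivity), Real.log_pow]
      push_cast
      field_simp
      rfl
    have hfac : 0 < 1 - 2 * (Real.log l / l) := by linarith
    have hlogy0 : 0 < Real.log y := by rw [hlogy]; positivity
    have hbound : ∑ p ∈ Finset.Ioc 0 ⌊x⌋₊ with p.Prime, c p ≤
        y + (∑ p ∈ Finset.Ioc 0 ⌊x⌋₊ with p.Prime, c p * Real.log p) / Real.log y := by
      have h1 : ∑ p ∈ Finset.Ioc 0 ⌊x⌋₊ with p.Prime, c p ≤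
          ∑ p ∈ Finset.Ioc 0 ⌊x⌋₊ with p.Prime,
            ((if p ∈ Finset.Ioc 0 ⌊y⌋₊ then 1 else 0) + c p * Real.log p / Real.log y) := by
        refine Finset.sum_le_sum fun p hp => ?_
        simp only [Finset.mem_filter, Finset.mem_Ioc] at hp
        have hn : 0 ≤ c p * Real.log p / Real.log y :=
          div_nonneg (mul_nonneg (hc0 p) (Real.log_natCast_nonneg p)) hlogy0.le
        split_ifs with hpy
        · linarith [hc1 p]
        · rw [zero_add, le_div_iff₀ hlogy0]
          refine mul_le_mul_of_nonneg_left (Real.log_le_log hy0 ?_) (hc0 p)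
          rw [Finset.mem_Ioc] at hpy
          have : ⌊y⌋₊ < p := by
            by_contra hh
            exact hpy ⟨hp.1.1, not_lt.1 hh⟩
          exact (Nat.lt_of_floor_lt this).le
      refine h1.trans ?_
      rw [Finset.sum_add_distrib, ← Finset.sum_div]
      refine add_le_add ?_ le_rfl
      rw [← Finset.sum_filter, Finset.sum_const, nsmul_eq_mul, mul_one]
      refine le_trans ?_ (Nat.floor_le hy0.le)
      have : ((Finset.Ioc 0 ⌊x⌋₊ |>.filter Nat.Prime).filter (· ∈ Finset.Ioc 0 ⌊y⌋₊)).card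
          ≤ (Finset.Ioc 0 ⌊y⌋₊).card :=
        Finset.card_le_card fun p hp => (Finset.mem_filter.1 hp).2
      rw [Nat.card_Ioc] at this
      exact_mod_cast this
    calc _ ≤ (y + (∑ p ∈ Finset.Ioc 0 ⌊x⌋₊ with p.Prime, c p * Real.log p) / Real.log y) * l / x := by
          gcongr
      _ = _ := by
          rw [hlogy, hy]
          field_simp

lemma card_eq_sum (Q : ℕ → Prop) [DecidablePred Q] (x : ℕ) :
    (Nat.card {p : ℕ // p ≤ x ∧ p.Prime ∧ Q p} : ℝ) =
      ∑ p ∈ Finset.Ioc 0 ⌊(x : ℝ)⌋₊ with p.Prime, (if Q p then (1 : ℝ) else 0) := by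
  rw [Nat.floor_natCast, ← Finset.sum_filter, Finset.sum_const, nsmul_eq_mul, mul_one]
  congr 1
  refine Nat.subtype_card _ fun p => ?_
  simp only [Finset.mem_filter, Finset.mem_Ioc]
  constructor
  · rintro ⟨⟨⟨_, h1⟩, h2⟩, h3⟩
    exact ⟨h1, h2, h3⟩
  · rintro ⟨h1, h2, h3⟩
    exact ⟨⟨⟨h2.pos, h1⟩, h2⟩, h3⟩

end AlgPart

/-- for f ∈ ℤ[x] irreducible over ℚ of degree ≥ 2, the set of primes p
such that f has no root modulo p has positive natural density; in particular it is
infinite. -/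
theorem stmt_2 (f : Polynomial ℤ)
    (hirr : Irreducible (f.map (Int.castRingHom ℚ)))
    (hdeg : 2 ≤ f.natDegree) :
    (∃ δ : ℝ, 0 < δ ∧
      Filter.Tendsto (fun x : ℕ =>
        (Nat.card {p : ℕ // p ≤ x ∧ p.Prime ∧ ∀ a : ℤ, ¬ (p : ℤ) ∣ f.eval a} : ℝ) /
        (Nat.card {p : ℕ // p ≤ x ∧ p.Prime} : ℝ))
        Filter.atTop (nhds δ)) ∧
    {p : ℕ | p.Prime ∧ ∀ a : ℤ, ¬ (p : ℤ) ∣ f.eval a}.Infinite := by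
  classical
  obtain ⟨g, hg, hgi, hgd, D, hD, hiff⟩ := AlgPart.normalize f hirr hdeg
  obtain ⟨δ, hδ, hmean⟩ := AlgPart.indicator_mean g hg hgi hgd
  have hmf : AlgPart.HasLogMean
      (fun p => if (∀ a : ℤ, ¬ (p : ℤ) ∣ f.eval a) then 1 else 0) δ :=
    hmean.congr D hD fun p hp hpD => by
      rw [if_congr (hiff p hp hpD) rfl rfl]
  refine ⟨⟨δ, hδ, ?_⟩, ?_⟩
  · have h1 := AlgPart.count_of_mean hmf (fun p => by positivity) (fun p => by split_ifs <;> norm_num)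
    have h2 := AlgPart.count_of_mean (AlgPart.moments_rat g hg hgi hgd).1 (fun p => by norm_num)
      (fun p => le_rfl)
    have h3 := ((h1.div h2 one_ne_zero).comp tendsto_natCast_atTop_atTop)
    rw [div_one] at h3
    refine h3.congr' ?_
    filter_upwards [Filter.eventually_gt_atTop 1] with x hx
    have hx1 : (1 : ℝ) < x := by exact_mod_cast hx
    have hlog : Real.log x ≠ 0 := (Real.log_pos hx1).ne'
    have hx0 : (x : ℝ) ≠ 0 := by positivity
    have hden : (Nat.card {p : ℕ // p ≤ x ∧ p.Prime} : ℝ) =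
        ∑ p ∈ Finset.Ioc 0 ⌊(x : ℝ)⌋₊ with p.Prime, (1 : ℝ) := by
      simpa using AlgPart.card_eq_sum (fun _ => True) x
    rw [AlgPart.card_eq_sum, hden]
    simp only [Function.comp, Pi.div_apply]
    rw [div_div_div_cancel_right₀ hx0, mul_div_mul_right _ _ hlog]
  · intro hfin
    have hB : ∃ D' : ℕ, D' ≠ 0 ∧ ∀ p : ℕ, p.Prime → ¬ p ∣ D' →
        (if (∀ a : ℤ, ¬ (p : ℤ) ∣ f.eval a) then (1 : ℝ) else 0) = 0 := by
      refine ⟨∏ p ∈ hfin.toFinset, p, Finset.prod_ne_zero_iff.2 fun p hp => ?_, fun p hp hpD => ?_⟩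
      · exact ((hfin.mem_toFinset).1 hp).1.ne_zero
      · rw [if_neg]
        intro hall
        exact hpD (Finset.dvd_prod_of_mem (fun q : ℕ => q) (hfin.mem_toFinset.2 ⟨hp, hall⟩))
    obtain ⟨D', hD', h'⟩ := hB
    have h0 := hmf.congr (c' := fun _ => 0) D' hD' h'
    have := tendsto_nhds_unique h0 AlgPart.hasLogMean_zero
    exact hδ.ne' this
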